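/- arXiv:2305.02986 — 13 statements merged into one kernel-verified Lean document; each statement's English description precedes it below -/
import Mathlib

section
/- For every chores instance with n agents and every allocation A of that instance, if A is envy-free up to one chore (EF1), then A is envy-free up to n(n-1) dubious chores (DEF-(n(n-1))). -/
open Finset

variable {N M : Type*}

/-- An allocation partitions the chores `M` into bundles, one per agent. -/
def IsAllocation [DecidableEq M] (A : N → Finset M) : Prop :=
  (∀ i j : N, i ≠ j → Disjoint (A i) (A j)) ∧ ∀ c : M, ∃ i : N, c ∈ A i

/-- Additive value of a bundle. -/
def val (v : M → ℤ) (S : Finset M) : ℤ := ∑ c ∈ S, v c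

/-- Envy-freeness up to `k` dubious chores. -/
def DEF [Fintype N] (v : N → M → ℤ) (A : N → Finset M) (k : ℕ) : Prop :=
  ∃ D : N → Multiset M,
    (∑ i : N, Multiset.card (D i)) ≤ k ∧
    ∀ i h : N, i ≠ h →
      val (v i) (A i) ≥ val (v i) (A h) + (Multiset.map (v i) (D h)).sum

/-- Envy-freeness up to one chore. -/
def EF1 [DecidableEq M] (v : N → M → ℤ) (A : N → Finset M) : Prop :=
  ∀ i h : N, i ≠ h → A i ≠ ∅ →
    ∃ c ∈ A i, val (v i) ((A i).erase c) ≥ val (v i) (A h)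

/-- Pareto optimality. -/
def ParetoOptimal [DecidableEq M] (v : N → M → ℤ) (A : N → Finset M) : Prop :=
  ¬ ∃ B : N → Finset M, IsAllocation B ∧
      (∀ i, val (v i) (B i) ≥ val (v i) (A i)) ∧
      ∃ j, val (v j) (B j) > val (v j) (A j)

/-- Total price of a bundle. -/
def price (p : M → ℝ) (S : Finset M) : ℝ := ∑ c ∈ S, p c

/-- Fisher market equilibrium: prices are positive and every agent receives only
its minimum pain per buck chores. -/
def FisherEq (v : N → M → ℤ) (p : M → ℝ) (A : N → Finset M) : Prop :=
  (∀ c, 0 < p c) ∧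
  ∀ i : N, ∀ c ∈ A i, ∀ c' : M, |(v i c : ℝ)| / p c ≤ |(v i c' : ℝ)| / p c'

/-- Price envy-freeness up to one item. -/
def pEF1 [DecidableEq M] (p : M → ℝ) (A : N → Finset M) : Prop :=
  ∀ i j : N, A i = ∅ ∨ ∃ c ∈ A i, price p ((A i).erase c) ≤ price p (A j)

/-- In an EF1 chores allocation, at most one dubious chore eliminates the envy of `i` towards `h`. -/
theorem EF1.exists_card_le_one [DecidableEq M] {v : N → M → ℤ} (hv : ∀ i c, v i c ≤ 0)
    {A : N → Finset M} (hEF1 : EF1 v A) {i h : N} (hih : i ≠ h) :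
    ∃ s : Multiset M, Multiset.card s ≤ 1 ∧
      val (v i) (A h) + (s.map (v i)).sum ≤ val (v i) (A i) := by
  by_cases hAi : A i = ∅
  · refine ⟨0, by simp, ?_⟩
    simpa [_root_.val, hAi] using Finset.sum_nonpos fun c (_ : c ∈ A h) => hv i c
  · obtain ⟨c, hc, hle⟩ := hEF1 i h hih hAi
    refine ⟨{c}, by simp, ?_⟩
    have hsum : val (v i) ((A i).erase c) + v i c = val (v i) (A i) :=
      Finset.sum_erase_add _ _ hc
    simp only [Multiset.map_singleton, Multiset.sum_singleton]
    linarith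

/-- every EF1 allocation of a chores instance with `n` agents
is DEF-(n(n-1)). -/
theorem ef1_implies_def_n_n_sub_one {n : ℕ} {M : Type*} [Fintype M] [DecidableEq M]
    (v : Fin n → M → ℤ) (hv : ∀ i c, v i c ≤ 0)
    (A : Fin n → Finset M) (hA : IsAllocation A)
    (hEF1 : EF1 v A) :
    DEF v A (n * (n - 1)) := by
  choose! f hcard hval using fun i h (hih : i ≠ h) => hEF1.exists_card_le_one hv hih
  refine ⟨fun h => ∑ i ∈ univ.erase h, f i h, ?_, fun i h hih => ?_⟩
  · calc ∑ h, Multiset.card (∑ i ∈ univ.erase h, f i h)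
        ≤ ∑ _h : Fin n, (n - 1) := Finset.sum_le_sum fun h _ => by
          rw [Multiset.card_sum]
          simpa using Finset.sum_le_card_nsmul (univ.erase h) _ 1
            fun i hi => hcard i h (Finset.ne_of_mem_erase hi)
      _ = n * (n - 1) := by simp
  · dsimp only
    rw [← Finset.add_sum_erase _ _ (Finset.mem_erase.2 ⟨hih, mem_univ i⟩), Multiset.map_add,
      Multiset.sum_add]
    have hrest : (Multiset.map (v i) (∑ j ∈ (univ.erase h).erase i, f j h)).sum ≤ 0 :=
      (Multiset.sum_le_card_nsmul _ 0 fun x hx => by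
        obtain ⟨c, -, rfl⟩ := Multiset.mem_map.1 hx
        exact hv i c).trans_eq (smul_zero _)
    linarith [hval i h hih]
end

section
/- For every n ≥ 2, consider the chores instance with n agents and n chores c_1,…,c_n in which v_i(c_i) = -1 and v_i(c_j) = 0 for every j ≠ i, and the allocation A with A_i = {c_i} for every agent i. Then A is envy-free up to one chore (EF1), A is DEF-(n(n-1)), but A is not DEF-k for any integer k with 0 ≤ k < n(n-1). -/
open Finset

variable {N M : Type*}

/-- The sum over a multiset of the function that is `-1` at `i` and `0` elsewhere. -/
lemma sum_map_ite_neg_one_eq_neg_count {α : Type*} [DecidableEq α] (i : α) (s : Multiset α) :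
    (s.map fun c => if c = i then (-1 : ℤ) else 0).sum = -(s.count i : ℤ) := by
  induction s using Multiset.induction_on with
  | empty => simp
  | cons a s ih =>
    rw [Multiset.map_cons, Multiset.sum_cons, ih, Multiset.count_cons]
    by_cases h : a = i
    · simp [h]
    · simp [h, Ne.symm h]

/-- In the diagonal instance, a dubious allocation removes all envy exactly when every agent's
dubious bundle contains the chore of every other agent. -/
lemma diagonal_dubious_envy_free_iff {n : ℕ} {v : Fin n → Fin n → ℤ}
    (hv : ∀ i c : Fin n, v i c = if c = i then -1 else 0)
    {A : Fin n → Finset (Fin n)} (hA : ∀ i : Fin n, A i = {i}) (D : Fin n → Multiset (Fin n)) :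
    (∀ i h : Fin n, i ≠ h →
      val (v i) (A i) ≥ val (v i) (A h) + (Multiset.map (v i) (D h)).sum) ↔
    ∀ i h : Fin n, i ≠ h → i ∈ D h := by
  refine forall_congr' fun i => forall_congr' fun h => imp_congr_right fun hih => ?_
  rw [show v i = fun c => if c = i then (-1 : ℤ) else 0 from funext (hv i),
    sum_map_ite_neg_one_eq_neg_count, ← Multiset.one_le_count_iff_mem]
  simp only [_root_.val, hA, sum_singleton, if_true, if_neg hih.symm]
  omega

/-- the diagonal instance with `v_i(c_i) = -1`, `v_i(c_j) = 0` for `j ≠ i`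
and allocation `A_i = {c_i}` is EF1 and DEF-(n(n-1)), but not DEF-k for any `k < n(n-1)`. -/
theorem diagonal_instance_ef1_def_tight (n : ℕ) (hn : 2 ≤ n)
    (v : Fin n → Fin n → ℤ) (hv : ∀ i c : Fin n, v i c = if c = i then -1 else 0)
    (A : Fin n → Finset (Fin n)) (hA : ∀ i : Fin n, A i = {i}) :
    EF1 v A ∧ DEF v A (n * (n - 1)) ∧ ∀ k : ℕ, k < n * (n - 1) → ¬ DEF v A k := by
  refine ⟨?_, ?_, ?_⟩
  · intro i h hih _
    exact ⟨i, by simp [hA], by simp [hA, _root_.val, hv, hih]⟩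
  · refine ⟨fun h => (univ.erase h).val, ?_, ?_⟩
    · simp
    · rw [diagonal_dubious_envy_free_iff hv hA]
      intro i h hih
      exact mem_erase.mpr ⟨hih, mem_univ i⟩
  · rintro k hk ⟨D, hD, hE⟩
    rw [diagonal_dubious_envy_free_iff hv hA] at hE
    have hcard (h : Fin n) : n - 1 ≤ Multiset.card (D h) := by
      calc n - 1 = #(univ.erase h) := by simp
        _ ≤ #(D h).toFinset := card_le_card fun i hi => by
          simpa using hE i h (ne_of_mem_erase hi)
        _ ≤ Multiset.card (D h) := Multiset.toFinset_card_le _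
    have hsum : n * (n - 1) ≤ ∑ h, Multiset.card (D h) := by
      simpa using card_nsmul_le_sum univ _ (n - 1) fun h _ => hcard h
    omega
end

section
/- For every n ≥ 2, consider the chores instance with n agents and n chores c_1,…,c_n in which every agent i has v_i(c_j) = -1 for all j ≤ n-1 and v_i(c_n) = -n. Then no allocation of this instance is DEF-k for any integer k with 0 ≤ k ≤ n-2; hence the bound n-1 on the number of dubious chores needed for the existence of a DEF-k allocation is tight. -/
open Finset

variable {N M : Type*}

/-- in the instance with `n` chores where the first `n-1` chores are valued
`-1` by everyone and the last chore is valued `-n` by everyone, no allocation is DEF-k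
for any `k ≤ n-2`. -/
theorem no_def_n_sub_two (n : ℕ) (hn : 2 ≤ n)
    (v : Fin n → Fin n → ℤ)
    (hv : ∀ i c : Fin n, v i c = if (c : ℕ) = n - 1 then -(n : ℤ) else -1)
    (A : Fin n → Finset (Fin n)) (hA : IsAllocation A)
    (k : ℕ) (hk : k ≤ n - 2) :
    ¬ DEF v A k := by
  rintro ⟨D, hD, henvy⟩
  let last : Fin n := ⟨n - 1, by omega⟩
  obtain ⟨a, ha⟩ := hA.2 last
  have hbig : val (v a) (A a) ≤ -n := by
    have hle : -v a last ≤ ∑ c ∈ A a, -v a c := by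
      refine single_le_sum (f := fun c => -v a c) (fun c _ => ?_) ha
      rw [hv]
      split_ifs <;> omega
    rw [sum_neg_distrib] at hle
    have hval : v a last = -n := by simp [hv, last]
    simp only [_root_.val]
    omega
  have hpos : ∀ h ∈ univ.erase a, 1 ≤ Multiset.card (D h) := by
    intro h hh
    have hne : a ≠ h := (ne_of_mem_erase hh).symm
    have hlast : last ∉ A h := disjoint_left.1 (hA.1 a h hne) ha
    have hsmall : val (v a) (A h) = -((A h).card : ℤ) := by
      have hunit : ∀ c ∈ A h, v a c = -1 := by
        intro c hc
        rw [hv, if_neg]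
        intro hcn
        exact hlast ((Fin.ext hcn : c = last) ▸ hc)
      simp [_root_.val, sum_congr rfl hunit]
    have hcard : (A h).card < n := by
      simpa using card_lt_univ_of_notMem hlast
    by_contra hlt
    have hempty : D h = 0 := Multiset.card_eq_zero.1 (by omega)
    have := henvy a h hne
    simp only [hempty, Multiset.map_zero, Multiset.sum_zero] at this
    omega
  have hsum : (univ.erase a).card • 1 ≤ ∑ h ∈ univ.erase a, Multiset.card (D h) :=
    card_nsmul_le_sum _ _ _ hpos
  have hsub : ∑ h ∈ univ.erase a, Multiset.card (D h) ≤ ∑ h, Multiset.card (D h) :=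
    sum_le_sum_of_subset (erase_subset _ _)
  simp only [card_erase_of_mem (mem_univ a), card_univ, Fintype.card_fin, smul_eq_mul,
    mul_one] at hsum
  omega
end

section
/- Let (A,p) be a Fisher market equilibrium of a chores instance. Then for all agents i and j with p(A_i) ≤ p(A_j), agent i does not envy agent j, i.e. v_i(A_i) ≥ v_i(A_j). In particular, no agent envies an agent whose bundle has maximum price. -/
open Finset

variable {N M : Type*}

/-- in a Fisher market equilibrium of a chores instance, no agent envies
an agent whose bundle has a (weakly) larger price. -/
theorem fisher_equilibrium_no_envy_towards_pricier {n : ℕ} {M : Type*}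
    [Fintype M] [DecidableEq M]
    (v : Fin n → M → ℤ) (hv : ∀ i c, v i c ≤ 0)
    (p : M → ℝ) (A : Fin n → Finset M) (hA : IsAllocation A)
    (heq : FisherEq v p A) :
    ∀ i j : Fin n, price p (A i) ≤ price p (A j) →
      val (v i) (A i) ≥ val (v i) (A j) := by
  intro i j hij
  obtain ⟨hp, hmpb⟩ := heq
  rcases (A i).eq_empty_or_nonempty with hempty | ⟨c₀, hc₀⟩
  · rw [hempty]
    simpa [_root_.val] using Finset.sum_nonpos fun c _ => hv i c
  · let α : ℝ := |(v i c₀ : ℝ)| / p c₀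
    have hα_nonneg : 0 ≤ α := div_nonneg (abs_nonneg _) (hp c₀).le
    have habs (c : M) : |(v i c : ℝ)| = -(v i c : ℝ) :=
      abs_of_nonpos (by exact_mod_cast hv i c)
    have hown : -(val (v i) (A i) : ℝ) ≤ α * price p (A i) := by
      rw [_root_.val, price, Int.cast_sum, ← Finset.sum_neg_distrib, Finset.mul_sum]
      refine Finset.sum_le_sum fun c hc => ?_
      rw [← habs c, ← div_le_iff₀ (hp c)]
      exact hmpb i c hc c₀
    have hother : α * price p (A j) ≤ -(val (v i) (A j) : ℝ) := by
      rw [_root_.val, price, Int.cast_sum, ← Finset.sum_neg_distrib, Finset.mul_sum]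
      refine Finset.sum_le_sum fun c _ => ?_
      rw [← habs c, ← le_div_iff₀ (hp c)]
      exact hmpb i c₀ hc₀ c
    have hprice := mul_le_mul_of_nonneg_left hij hα_nonneg
    have hval : (val (v i) (A j) : ℝ) ≤ val (v i) (A i) := by linarith
    exact_mod_cast hval
end

section
/- Let (A,p) be a Fisher market equilibrium of a chores instance with n agents in which every agent values every chore strictly negatively, and suppose (A,p) is price envy-free up to one item (pEF1). Then the allocation A is DEF-(n-1) and Pareto optimal. Moreover, assigning one dubious copy of a maximum-price chore to each agent other than an agent whose bundle has maximum price makes the augmented allocation envy-free. -/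
open Finset

variable {N M : Type*}

/-- The prices of the bundles of an allocation add up to the total price of all chores. -/
theorem IsAllocation.sum_price {N M : Type*} [Fintype N] [Fintype M] [DecidableEq M]
    {A : N → Finset M} (hA : IsAllocation A) (p : M → ℝ) :
    ∑ i, price p (A i) = ∑ c, p c := by
  have hU : (univ : Finset M) = univ.biUnion A := by
    ext c
    simpa using hA.2 c
  rw [hU, Finset.sum_biUnion fun i _ j _ hij => hA.1 i j hij]
  rfl

/-- In a Fisher equilibrium every agent has a positive pain-per-buck ratio `α` such that every
chore costs the agent at least `α` times its price, with equality on the agent's own bundle. -/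
theorem FisherEq.exists_pain_per_buck {N M : Type*} [Fintype M] {v : N → M → ℤ}
    (hv : ∀ i c, v i c < 0) {p : M → ℝ} {A : N → Finset M} (h : FisherEq v p A) (i : N) :
    ∃ α : ℝ, 0 < α ∧ (∀ c, (v i c : ℝ) ≤ -α * p c) ∧ ∀ c ∈ A i, (v i c : ℝ) = -α * p c := by
  rcases isEmpty_or_nonempty M with hM | hM
  · exact ⟨1, one_pos, fun c => isEmptyElim c, fun c => isEmptyElim c⟩
  obtain ⟨c₀, hc₀⟩ := Finite.exists_min fun c => |(v i c : ℝ)| / p c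
  have hneg : ∀ c, (v i c : ℝ) < 0 := fun c => by exact_mod_cast hv i c
  have hle : ∀ c, (v i c : ℝ) ≤ -(|(v i c₀ : ℝ)| / p c₀) * p c := fun c => by
    have := (le_div_iff₀ (h.1 c)).1 (hc₀ c)
    rw [abs_of_neg (hneg c)] at this
    linarith
  refine ⟨|(v i c₀ : ℝ)| / p c₀, div_pos (abs_pos.2 (hneg c₀).ne) (h.1 c₀), hle,
    fun c hc => le_antisymm (hle c) ?_⟩
  have := (div_le_iff₀ (h.1 c)).1 (h.2 i c hc c₀)
  rw [abs_of_neg (hneg c)] at this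
  linarith

theorem val_le_neg_mul_price {M : Type*} {v : M → ℤ} {p : M → ℝ} {α : ℝ}
    (h : ∀ c, (v c : ℝ) ≤ -α * p c) (S : Finset M) : (val v S : ℝ) ≤ -α * price p S := by
  unfold _root_.val price
  push_cast
  rw [Finset.mul_sum]
  exact Finset.sum_le_sum fun c _ => h c

theorem val_eq_neg_mul_price {M : Type*} {v : M → ℤ} {p : M → ℝ} {α : ℝ} {S : Finset M}
    (h : ∀ c ∈ S, (v c : ℝ) = -α * p c) : (val v S : ℝ) = -α * price p S := by
  unfold _root_.val price
  push_cast
  rw [Finset.mul_sum]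
  exact Finset.sum_congr rfl h

/-- First welfare theorem for chores. -/
theorem FisherEq.paretoOptimal {N M : Type*} [Fintype N] [Fintype M] [DecidableEq M]
    {v : N → M → ℤ} (hv : ∀ i c, v i c < 0) {p : M → ℝ} {A : N → Finset M}
    (hA : IsAllocation A) (h : FisherEq v p A) : ParetoOptimal v A := by
  rintro ⟨B, hB, hle, j, hj⟩
  have hprice : ∀ i, price p (B i) ≤ price p (A i) := fun i => by
    obtain ⟨α, hα, h₁, h₂⟩ := h.exists_pain_per_buck hv i
    have hi : (val (v i) (A i) : ℝ) ≤ val (v i) (B i) := by exact_mod_cast hle i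
    have hBi := val_le_neg_mul_price h₁ (B i)
    rw [val_eq_neg_mul_price h₂] at hi
    exact le_of_mul_le_mul_left (by linarith) hα
  have hlt : price p (B j) < price p (A j) := by
    obtain ⟨α, hα, h₁, h₂⟩ := h.exists_pain_per_buck hv j
    have hj' : (val (v j) (A j) : ℝ) < val (v j) (B j) := by exact_mod_cast hj
    have hBj := val_le_neg_mul_price h₁ (B j)
    rw [val_eq_neg_mul_price h₂] at hj'
    exact lt_of_mul_lt_mul_left (by linarith) hα.le
  have hsum := Finset.sum_lt_sum (fun i _ => hprice i) ⟨j, mem_univ j, hlt⟩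
  rw [hB.sum_price, hA.sum_price] at hsum
  exact hsum.false

/-- One copy of a maximum-price chore for every agent but one with a maximum-price bundle
removes all envy from a pEF1 Fisher equilibrium. -/
theorem FisherEq.envyFree_of_pEF1 {N M : Type*} [DecidableEq N] [Fintype M] [DecidableEq M]
    {v : N → M → ℤ} (hv : ∀ i c, v i c < 0) {p : M → ℝ} {A : N → Finset M}
    (heq : FisherEq v p A) (hpef1 : pEF1 p A) {cmax : M} (hc : ∀ c, p c ≤ p cmax)
    {imax : N} (hi : ∀ i, price p (A i) ≤ price p (A imax)) (i h : N) :
    val (v i) (A i) ≥ val (v i) (A h) + (if h = imax then 0 else v i cmax) := by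
  obtain ⟨α, hα, h₁, h₂⟩ := heq.exists_pain_per_buck hv i
  have hAi := val_eq_neg_mul_price h₂
  have hAh := val_le_neg_mul_price h₁ (A h)
  split_ifs with hh
  · subst hh
    have := mul_le_mul_of_nonneg_left (hi i) hα.le
    have : (val (v i) (A h) : ℝ) ≤ val (v i) (A i) := by linarith
    have : val (v i) (A h) ≤ val (v i) (A i) := by exact_mod_cast this
    linarith
  · have hp : price p (A i) ≤ price p (A h) + p cmax := by
      rcases hpef1 i h with he | ⟨c, hcA, hle⟩
      · have h0 : 0 ≤ price p (A h) := Finset.sum_nonneg fun c _ => (heq.1 c).le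
        have h1 : price p (A i) = 0 := by simp [price, he]
        linarith [heq.1 cmax]
      · have hs : price p ((A i).erase c) + p c = price p (A i) :=
          Finset.sum_erase_add _ _ hcA
        linarith [hc c]
    have := mul_le_mul_of_nonneg_left hp hα.le
    have : (val (v i) (A h) + v i cmax : ℝ) ≤ val (v i) (A i) := by linarith [h₁ cmax]
    exact_mod_cast this

/-- a pEF1 Fisher market equilibrium of a chores instance with strictly
negative valuations yields a DEF-(n-1) and Pareto optimal allocation; moreover giving one
dubious copy of a maximum-price chore to each agent other than a maximum-price-bundle
agent makes the augmented allocation envy-free. -/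
theorem pef1_fisher_equilibrium_def_po {n : ℕ} {M : Type*} [Fintype M] [DecidableEq M]
    (v : Fin n → M → ℤ) (hv : ∀ i c, v i c < 0)
    (p : M → ℝ) (A : Fin n → Finset M) (hA : IsAllocation A)
    (heq : FisherEq v p A) (hpef1 : pEF1 p A) :
    (DEF v A (n - 1) ∧ ParetoOptimal v A) ∧
    ∀ cmax : M, (∀ c : M, p c ≤ p cmax) →
      ∀ imax : Fin n, (∀ i : Fin n, price p (A i) ≤ price p (A imax)) →
        ∀ i h : Fin n, i ≠ h →
          val (v i) (A i) ≥ val (v i) (A h) + (if h = imax then 0 else v i cmax) := by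
  refine ⟨⟨?_, heq.paretoOptimal hv hA⟩,
    fun cmax hc imax hi i h _ => heq.envyFree_of_pEF1 hv hpef1 hc hi i h⟩
  rcases isEmpty_or_nonempty M with hM | hM
  · exact ⟨fun _ => 0, by simp, fun i h _ => by simp [_root_.val, Finset.eq_empty_of_isEmpty]⟩
  obtain ⟨cmax, hc⟩ := Finite.exists_max p
  obtain ⟨i₀, -⟩ := hA.2 cmax
  have : Nonempty (Fin n) := ⟨i₀⟩
  obtain ⟨imax, hi⟩ := Finite.exists_max fun i => price p (A i)
  refine ⟨fun h => if h = imax then 0 else {cmax}, ?_, fun i h _ => ?_⟩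
  · have hcard : ∀ h : Fin n,
        Multiset.card (if h = imax then (0 : Multiset M) else {cmax}) = if h = imax then 0 else 1 :=
      fun h => by split_ifs <;> simp
    simp only [hcard]
    rw [← Finset.add_sum_erase _ _ (mem_univ imax),
      Finset.sum_congr rfl fun h hh => if_neg (Finset.ne_of_mem_erase hh)]
    simp
  · have := heq.envyFree_of_pEF1 hv hpef1 hc hi i h
    by_cases hh : h = imax <;> simpa [hh] using this
end

section
/- Let (A,p) be a Fisher market equilibrium of a chores instance with n agents such that for every agent i: either p(A_i) ≤ 1 and there exists a chore c ∈ M with p(A_i) + p(c) ≥ 1, or p(A_i) > 1 and there exists a chore c ∈ A_i with p(A_i) - p(c) < 1. Then the allocation A is DEF-(2n-2); indeed, assigning two dubious copies of a maximum-price chore to each agent other than an agent whose bundle has maximum price makes the augmented allocation envy-free. -/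
open Finset

variable {N M : Type*}

/-- In a Fisher market equilibrium, an agent does not envy a bundle `S` augmented by `k` copies of a
chore `c` if the augmented bundle is at least as expensive as the agent's own. -/
lemma FisherEq.val_ge_of_price_le {v : N → M → ℤ} (hv : ∀ i c, v i c ≤ 0) {p : M → ℝ}
    {A : N → Finset M} (heq : FisherEq v p A) (i : N) (S : Finset M) (c : M) (k : ℕ)
    (h : price p (A i) ≤ price p S + k * p c) :
    val (v i) S + k * v i c ≤ val (v i) (A i) := by
  obtain ⟨hp, hmpb⟩ := heq
  have hS : val (v i) S ≤ 0 := Finset.sum_nonpos fun c _ => hv i c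
  rcases (A i).eq_empty_or_nonempty with hE | ⟨c₀, hc₀⟩
  · have hk : (k : ℤ) * v i c ≤ 0 := mul_nonpos_of_nonneg_of_nonpos (by positivity) (hv i c)
    have h0 : val (v i) (A i) = 0 := by simp [_root_.val, hE]
    lia
  · set α := |(v i c₀ : ℝ)| / p c₀
    have hα : 0 ≤ α := div_nonneg (abs_nonneg _) (hp c₀).le
    have habs (d : M) : |(v i d : ℝ)| = -(v i d : ℝ) :=
      abs_of_nonpos (by exact_mod_cast hv i d)
    have hle (d : M) : (v i d : ℝ) ≤ -α * p d := by
      have := (le_div_iff₀ (hp d)).1 (hmpb i c₀ hc₀ d)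
      rw [habs d] at this
      linarith
    have hge (d : M) (hd : d ∈ A i) : -α * p d ≤ (v i d : ℝ) := by
      have := (div_le_iff₀ (hp d)).1 (hmpb i d hd c₀)
      rw [habs d] at this
      linarith
    have hown : -α * price p (A i) ≤ (val (v i) (A i) : ℝ) := by
      rw [price, _root_.val, Finset.mul_sum]
      push_cast
      exact Finset.sum_le_sum hge
    have hother : (val (v i) S : ℝ) ≤ -α * price p S := by
      rw [price, _root_.val, Finset.mul_sum]
      push_cast
      exact Finset.sum_le_sum fun d _ => hle d
    have hk : (k : ℝ) * v i c ≤ k * (-α * p c) :=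
      mul_le_mul_of_nonneg_left (hle c) (by positivity)
    have hmul := mul_le_mul_of_nonneg_left h hα
    have : (val (v i) S : ℝ) + k * v i c ≤ val (v i) (A i) := by linarith
    exact_mod_cast this

/-- a Fisher market equilibrium in which every bundle's price is close to 1
(in the sense of Barman-Krishnamurthy) is DEF-(2n-2); moreover giving two dubious copies
of a maximum-price chore to each agent other than a maximum-price-bundle agent makes the
augmented allocation envy-free. -/
theorem near_one_prices_def_two_n_sub_two {n : ℕ} {M : Type*} [Fintype M] [DecidableEq M]
    (v : Fin n → M → ℤ) (hv : ∀ i c, v i c ≤ 0)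
    (p : M → ℝ) (A : Fin n → Finset M) (hA : IsAllocation A)
    (heq : FisherEq v p A)
    (hprices : ∀ i : Fin n,
      (price p (A i) ≤ 1 ∧ ∃ c : M, price p (A i) + p c ≥ 1) ∨
      (price p (A i) > 1 ∧ ∃ c ∈ A i, price p (A i) - p c < 1)) :
    DEF v A (2 * n - 2) ∧
    ∀ cmax : M, (∀ c : M, p c ≤ p cmax) →
      ∀ imax : Fin n, (∀ i : Fin n, price p (A i) ≤ price p (A imax)) →
        ∀ i h : Fin n, i ≠ h →
          val (v i) (A i) ≥ val (v i) (A h) + (if h = imax then 0 else 2 * v i cmax) := by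
  have envyFree : ∀ cmax : M, (∀ c : M, p c ≤ p cmax) →
      ∀ imax : Fin n, (∀ i : Fin n, price p (A i) ≤ price p (A imax)) →
        ∀ i h : Fin n, i ≠ h →
          val (v i) (A i) ≥ val (v i) (A h) + (if h = imax then 0 else 2 * v i cmax) := by
    intro cmax hcmax imax himax i h _
    split_ifs with hh
    · subst hh
      simpa using heq.val_ge_of_price_le hv i (A h) cmax 0 (by simpa using himax i)
    · have hlow : 1 ≤ price p (A h) + p cmax := by
        have := heq.1 cmax
        rcases hprices h with ⟨_, c, hc⟩ | ⟨h1, _⟩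
        · linarith [hcmax c]
        · linarith
      have hup : price p (A i) ≤ 1 + p cmax := by
        have := heq.1 cmax
        rcases hprices i with ⟨h1, _⟩ | ⟨_, c, _, hc⟩
        · linarith
        · linarith [hcmax c]
      simpa using heq.val_ge_of_price_le hv i (A h) cmax 2 (by push_cast; linarith)
  refine ⟨?_, envyFree⟩
  rcases n.eq_zero_or_pos with rfl | hn
  · exact ⟨fun _ => 0, by simp, fun i => i.elim0⟩
  have : Nonempty (Fin n) := ⟨⟨0, hn⟩⟩
  have : Nonempty M := by
    rcases hprices ⟨0, hn⟩ with ⟨_, c, _⟩ | ⟨_, c, _⟩ <;> exact ⟨c⟩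
  obtain ⟨cmax, hcmax⟩ := Finite.exists_max p
  obtain ⟨imax, himax⟩ := Finite.exists_max fun i => price p (A i)
  refine ⟨fun h => if h = imax then 0 else Multiset.replicate 2 cmax, ?_, fun i h hih => ?_⟩
  · rw [← Finset.add_sum_erase _ _ (Finset.mem_univ imax),
      Finset.sum_congr rfl (g := fun _ => 2) fun h hh => by simp [Finset.ne_of_mem_erase hh]]
    simp
    lia
  · have := envyFree cmax hcmax imax himax i h hih
    by_cases hh : h = imax
    · simpa [hh] using this
    · simpa [hh, two_mul] using this
end

section
/- For every chores instance with n agents in which every agent values every chore strictly negatively, there exists an allocation that is both DEF-(2n-2) and Pareto optimal. -/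
open Finset

variable {N M : Type*}

theorem exists_ne_zero_of_card_add_card_lt [Fintype N] [Fintype M] [DecidableEq N] [DecidableEq M]
    (p : M → ℝ) (E : Finset (N × M)) (C : Finset M) (S : Finset N)
    (hEC : ∀ e ∈ E, e.2 ∈ C) (hcard : #C + #S < #E) :
    ∃ z : N → M → ℝ, (∃ i c, z i c ≠ 0) ∧ (∀ i c, (i, c) ∉ E → z i c = 0) ∧
      (∀ c, ∑ i, z i c = 0) ∧ ∀ i ∈ S, ∑ c, p c * z i c = 0 := by
  let φ : (N × M → ℝ) →ₗ[ℝ] ({e // e ∈ Eᶜ} ⊕ {c // c ∈ C} ⊕ {i // i ∈ S} → ℝ) :=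
    { toFun := fun z => Sum.elim (fun e => z e.1)
        (Sum.elim (fun c => ∑ i, z (i, c.1)) (fun i => ∑ c, p c * z (i.1, c)))
      map_add' := by
        intro z z'
        ext (e | c | i) <;> simp [sum_add_distrib, mul_add]
      map_smul' := by
        intro t z
        ext (e | c | i) <;> simp [mul_sum, mul_left_comm] }
  have hlt : Module.finrank ℝ ({e // e ∈ Eᶜ} ⊕ {c // c ∈ C} ⊕ {i // i ∈ S} → ℝ) <
      Module.finrank ℝ (N × M → ℝ) := by
    rw [Module.finrank_fintype_fun_eq_card, Module.finrank_fintype_fun_eq_card,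
      Fintype.card_sum, Fintype.card_sum, Fintype.card_coe, Fintype.card_coe, Fintype.card_coe]
    have := E.card_add_card_compl
    omega
  obtain ⟨z, hz, hz0⟩ := (Submodule.ne_bot_iff _).1 (LinearMap.ker_ne_bot_of_finrank_lt (f := φ) hlt)
  have hφ : φ z = 0 := hz
  have hE : ∀ i c, (i, c) ∉ E → z (i, c) = 0 := fun i c h =>
    congrFun hφ (Sum.inl ⟨(i, c), mem_compl.2 h⟩)
  refine ⟨fun i c => z (i, c), ?_, hE, fun c => ?_, fun i hi => congrFun hφ (Sum.inr (Sum.inr ⟨i, hi⟩))⟩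
  · obtain ⟨⟨i, c⟩, h⟩ := Function.ne_iff.1 hz0
    exact ⟨i, c, h⟩
  · by_cases hc : c ∈ C
    · exact congrFun hφ (Sum.inr (Sum.inl ⟨c, hc⟩))
    · exact sum_eq_zero fun i _ => hE i c fun h => hc (hEC _ h)

/-- A bipartite graph in which every touched right vertex and every vertex of `S` has degree at
least two supports a nonzero perturbation preserving column sums and the loads of `S`. -/
theorem exists_load_preserving_perturbation [Fintype N] [Fintype M] [DecidableEq N]
    [DecidableEq M] (p : M → ℝ) (E : Finset (N × M)) (S : Finset N) (hne : E.Nonempty)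
    (hM : ∀ e ∈ E, ∃ j ≠ e.1, (j, e.2) ∈ E) (hN : ∀ i ∈ S, 1 < #{e ∈ E | e.1 = i}) :
    ∃ z : N → M → ℝ, (∃ i c, z i c ≠ 0) ∧ (∀ i c, (i, c) ∉ E → z i c = 0) ∧
      (∀ c, ∑ i, z i c = 0) ∧ ∀ i ∈ S, ∑ c, p c * z i c = 0 := by
  have hC : 2 * #(E.image Prod.snd) ≤ #E := by
    rw [card_eq_sum_card_image Prod.snd E, mul_comm, ← smul_eq_mul]
    refine card_nsmul_le_sum _ _ _ fun c hc => ?_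
    obtain ⟨e, he, rfl⟩ := mem_image.1 hc
    obtain ⟨j, hj, hjE⟩ := hM e he
    refine one_lt_card.2 ⟨e, by simp [he], (j, e.2), by simp [hjE], fun h => hj ?_⟩
    rw [h]
  have hS : 2 * #S ≤ #{e ∈ E | e.1 ∈ S} := by
    rw [card_eq_sum_card_fiberwise (f := Prod.fst) (t := S) (by intro e he; simp_all),
      mul_comm, ← smul_eq_mul]
    refine card_nsmul_le_sum _ _ _ fun i hi => (hN i hi).trans_le (card_le_card ?_)
    intro e he
    simp only [mem_filter] at he ⊢
    exact ⟨⟨he.1, he.2 ▸ hi⟩, he.2⟩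
  have hEC : ∀ e ∈ E, e.2 ∈ E.image Prod.snd := fun e he => mem_image_of_mem _ he
  by_cases hout : ∃ e ∈ E, e.1 ∉ S
  · obtain ⟨e, he, heS⟩ := hout
    refine exists_ne_zero_of_card_add_card_lt p E _ S hEC ?_
    have : #{e ∈ E | e.1 ∈ S} < #E := card_lt_card (filter_ssubset.2 ⟨e, he, heS⟩)
    omega
  · push Not at hout
    obtain ⟨e, he⟩ := hne
    have heS := hout e he
    obtain ⟨z, hz, hzE, hz1, hzS⟩ :=
      exists_ne_zero_of_card_add_card_lt p E _ (S.erase e.1) hEC (by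
        have := card_erase_add_one heS
        have : #{e ∈ E | e.1 ∈ S} ≤ #E := card_filter_le _ _
        omega)
    refine ⟨z, hz, hzE, hz1, fun i hi => ?_⟩
    by_cases hie : i = e.1
    · subst hie
      have htot : ∑ j, ∑ c, p c * z j c = 0 := by
        rw [sum_comm]
        exact sum_eq_zero fun c _ => by rw [← mul_sum, hz1, mul_zero]
      rw [← htot]
      symm
      refine sum_eq_single_of_mem e.1 (mem_univ _) fun j _ hj => ?_
      by_cases hjS : j ∈ S
      · exact hzS j (mem_erase.2 ⟨hj, hjS⟩)
      · exact sum_eq_zero fun c _ => by rw [hzE j c fun h => hjS (hout _ h), mul_zero]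
    · exact hzS i (mem_erase.2 ⟨hie, hi⟩)

/-- Moving along a column-balanced direction until some positive entry vanishes. -/
theorem exists_support_reduction [Fintype N] [Fintype M] [DecidableEq N] [DecidableEq M]
    (x z : N → M → ℝ) (hx0 : ∀ i c, 0 ≤ x i c) (hz : ∃ i c, z i c ≠ 0)
    (hzx : ∀ i c, x i c = 0 → z i c = 0) (hz1 : ∀ c, ∑ i, z i c = 0) :
    ∃ t : ℝ, (∀ i c, 0 ≤ x i c + t * z i c) ∧ ∃ i c, x i c ≠ 0 ∧ x i c + t * z i c = 0 := by
  have hneg : ({e : N × M | z e.1 e.2 < 0} : Finset (N × M)).Nonempty := by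
    obtain ⟨i, c, h⟩ := hz
    by_contra hcon
    rw [not_nonempty_iff_eq_empty, filter_eq_empty_iff] at hcon
    have hnn : ∀ j ∈ univ, 0 ≤ z j c := fun j _ => not_lt.1 (hcon (mem_univ (j, c)))
    exact h ((sum_eq_zero_iff_of_nonneg hnn).1 (hz1 c) i (mem_univ i))
  obtain ⟨e, he, hmin⟩ := exists_min_image _ (fun e : N × M => x e.1 e.2 / -z e.1 e.2) hneg
  have hez : z e.1 e.2 < 0 := by simpa using he
  refine ⟨x e.1 e.2 / -z e.1 e.2, fun i c => ?_, e.1, e.2, fun h => hez.ne (hzx _ _ h), ?_⟩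
  · rcases lt_or_ge (z i c) 0 with h | h
    · have h1 := hmin (i, c) (by simpa using h)
      have h2 := (le_div_iff₀ (neg_pos.2 h)).1 h1
      linarith
    · exact add_nonneg (hx0 i c) (mul_nonneg (div_nonneg (hx0 _ _) (by linarith)) h)
  · field_simp [hez.ne]
    ring

/-- A fractional assignment can be rounded within its support so that the load of every agent in `S`
changes by at most the largest price. -/
theorem exists_rounding_of_active [Fintype N] [Fintype M] [DecidableEq N] [DecidableEq M]
    (p : M → ℝ) (B : ℝ) (hp0 : ∀ c, 0 ≤ p c) (hB : 0 ≤ B) (hpB : ∀ c, p c ≤ B) (k : ℕ)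
    (S : Finset N) (x : N → M → ℝ) (hk : #{e : N × M | x e.1 e.2 ≠ 0} + #S ≤ k)
    (hx0 : ∀ i c, 0 ≤ x i c) (hx1 : ∀ c, ∑ i, x i c = 1) :
    ∃ f : M → N, (∀ c, x (f c) c ≠ 0) ∧
      ∀ i ∈ S, |∑ c, p c * (if f c = i then 1 else 0) - ∑ c, p c * x i c| ≤ B := by
  induction k generalizing S x with
  | zero =>
    have hS : S = ∅ := card_eq_zero.1 (by omega)
    have hsupp := card_eq_zero.1 (show #{e : N × M | x e.1 e.2 ≠ 0} = 0 by omega)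
    have hcol : ∀ c, ∃ i, x i c ≠ 0 := fun c => by
      by_contra! h
      simpa [h] using hx1 c
    choose f hf using hcol
    exact ⟨f, hf, by simp [hS]⟩
  | succ k ih =>
    have hle1 : ∀ i c, x i c ≤ 1 := fun i c =>
      (single_le_sum (fun j _ => hx0 j c) (mem_univ i)).trans (hx1 c).le
    have huniq : ∀ i j c, x i c = 1 → x j c ≠ 0 → j = i := by
      intro i j c hi hj
      by_contra hij
      have := add_le_sum (fun l _ => hx0 l c) (mem_univ i) (mem_univ j) (Ne.symm hij)
      have := (hx0 j c).lt_of_ne' hj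
      linarith [hx1 c]
    set E : Finset (N × M) := {e | x e.1 e.2 ≠ 0 ∧ x e.1 e.2 ≠ 1} with hE
    have hterm : ∀ f : M → N, (∀ c, x (f c) c ≠ 0) → ∀ i c, (i, c) ∉ E →
        (if f c = i then (1 : ℝ) else 0) = x i c := by
      intro f hf i c h
      have h' : x i c ≠ 0 → x i c = 1 := by simpa [hE] using h
      by_cases h0 : x i c = 0
      · rw [h0, if_neg]
        rintro rfl
        exact hf c h0
      · rw [h' h0, if_pos (huniq i (f c) c (h' h0) (hf c))]
    by_cases hleaf : ∃ i ∈ S, #{e ∈ E | e.1 = i} ≤ 1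
    · obtain ⟨i, hi, hdeg⟩ := hleaf
      obtain ⟨f, hf, hfS⟩ := ih (S.erase i) x (by have := card_erase_add_one hi; omega) hx0 hx1
      refine ⟨f, hf, fun j hj => ?_⟩
      by_cases hji : j = i
      · subst hji
        rw [← sum_sub_distrib]
        by_cases hc : ∃ c, (j, c) ∈ E
        · obtain ⟨c, hc⟩ := hc
          rw [sum_eq_single_of_mem c (mem_univ c)]
          · rw [← mul_sub, abs_mul, abs_of_nonneg (hp0 c)]
            refine (mul_le_of_le_one_right (hp0 c) ?_).trans (hpB c)
            rw [abs_le]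
            have := hx0 j c
            have := hle1 j c
            split_ifs <;> constructor <;> linarith
          · intro c' _ hne
            rw [hterm f hf j c', sub_self]
            intro hc'
            exact hne (congrArg Prod.snd
              (card_le_one.1 hdeg (j, c') (by simp [hc']) (j, c) (by simp [hc])))
        · push Not at hc
          rw [sum_eq_zero fun c _ => by rw [hterm f hf j c (hc c), sub_self], abs_zero]
          exact hB
      · exact hfS j (mem_erase.2 ⟨hji, hj⟩)
    push Not at hleaf
    rcases E.eq_empty_or_nonempty with hE0 | hne
    · have hcol : ∀ c, ∃ i, x i c ≠ 0 := fun c => by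
        by_contra! h
        simpa [h] using hx1 c
      choose f hf using hcol
      refine ⟨f, hf, fun i _ => ?_⟩
      simp only [hterm f hf i _ (hE0 ▸ notMem_empty _), sub_self, abs_zero, hB]
    · obtain ⟨z, hz, hzE, hz1, hzS⟩ := exists_load_preserving_perturbation p E S hne (by
        rintro ⟨i, c⟩ he
        obtain ⟨h0, h1⟩ : x i c ≠ 0 ∧ x i c ≠ 1 := by simpa [hE] using he
        by_contra! hcon
        refine h1 ?_
        rw [← hx1 c]
        symm
        refine sum_eq_single_of_mem i (mem_univ i) fun j _ hj => ?_
        by_contra hj0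
        have hj1 : x j c = 1 := by
          by_contra hj1
          exact hcon j hj (by simp [hE, hj0, hj1])
        exact hj (huniq j i c hj1 h0).symm) hleaf
      have hzx : ∀ i c, x i c = 0 → z i c = 0 := fun i c h => hzE i c (by simp [hE, h])
      obtain ⟨t, ht0, i, c, hic, htic⟩ := exists_support_reduction x z hx0 hz hzx hz1
      obtain ⟨f, hf, hfS⟩ := ih S (fun i c => x i c + t * z i c) (by
          refine Nat.le_of_lt_succ (lt_of_lt_of_le (Nat.add_lt_add_right (card_lt_card ?_) _) hk)
          refine (ssubset_iff_of_subset fun e he => ?_).2 ⟨(i, c), by simpa using hic, by simp [htic]⟩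
          simp only [mem_filter, mem_univ, true_and] at he ⊢
          intro h
          exact he (by rw [h, hzx _ _ h, mul_zero, add_zero])) ht0
        (fun c => by rw [sum_add_distrib, ← mul_sum, hz1, hx1, mul_zero, add_zero])
      refine ⟨f, fun c h => hf c (by simp only [h, hzx _ _ h, mul_zero, add_zero]), fun i hi => ?_⟩
      have hload : ∑ c, p c * (x i c + t * z i c) = ∑ c, p c * x i c := by
        simp only [mul_add, sum_add_distrib, mul_left_comm _ t, ← mul_sum, hzS i hi, mul_zero,
          add_zero]
      rw [← hload]
      exact hfS i hi

/-- The cheapest weighted disutility at which some agent takes the chore `c`. -/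
noncomputable def minPain [Fintype N] [Nonempty N] (a : N → M → ℝ) (w : N → ℝ) (c : M) : ℝ :=
  univ.inf' univ_nonempty fun i => w i * a i c

theorem minPain_le [Fintype N] [Nonempty N] (a : N → M → ℝ) (w : N → ℝ) (i : N) (c : M) :
    minPain a w c ≤ w i * a i c :=
  inf'_le (f := fun i => w i * a i c) (mem_univ i)

theorem le_minPain [Fintype N] [Nonempty N] {a : N → M → ℝ} {w : N → ℝ} {c : M} {r : ℝ}
    (h : ∀ i, r ≤ w i * a i c) : r ≤ minPain a w c :=
  le_inf' _ _ fun i _ => h i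

theorem exists_minPain_eq [Fintype N] [Nonempty N] (a : N → M → ℝ) (w : N → ℝ) (c : M) :
    ∃ i, w i * a i c = minPain a w c := by
  obtain ⟨i, -, hi⟩ := exists_mem_eq_inf' univ_nonempty fun i => w i * a i c
  exact ⟨i, hi.symm⟩

theorem minPain_pos [Fintype N] [Nonempty N] {a : N → M → ℝ} {w : N → ℝ}
    (ha : ∀ i c, 0 < a i c) (hw : ∀ i, 0 < w i) (c : M) : 0 < minPain a w c := by
  obtain ⟨i, hi⟩ := exists_minPain_eq a w c
  exact hi ▸ mul_pos (hw i) (ha i c)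

theorem minPain_smul [Fintype N] [Nonempty N] (a : N → M → ℝ) (w : N → ℝ) (c : M) {r : ℝ}
    (hr : 0 ≤ r) : minPain a (r • w) c = r * minPain a w c := by
  refine le_antisymm ?_ (le_minPain fun i => ?_)
  · obtain ⟨i, hi⟩ := exists_minPain_eq a w c
    rw [← hi, ← mul_assoc]
    exact minPain_le a (r • w) i c
  · rw [Pi.smul_apply, smul_eq_mul, mul_assoc]
    exact mul_le_mul_of_nonneg_left (minPain_le a w i c) hr

/-- The logarithmic dual objective whose maximizers are weights of competitive equilibria. -/
noncomputable def dualObjective [Fintype N] [Nonempty N] [Fintype M] (a : N → M → ℝ)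
    (w : N → ℝ) : ℝ :=
  Fintype.card N * Real.log (∑ c, minPain a w c) - ∑ i, Real.log (w i)

theorem sum_minPain_pos [Fintype N] [Nonempty N] [Fintype M] [Nonempty M] {a : N → M → ℝ}
    {w : N → ℝ} (ha : ∀ i c, 0 < a i c) (hw : ∀ i, 0 < w i) : 0 < ∑ c, minPain a w c :=
  sum_pos (fun c _ => minPain_pos ha hw c) univ_nonempty

theorem dualObjective_smul [Fintype N] [Nonempty N] [Fintype M] [Nonempty M] {a : N → M → ℝ}
    {w : N → ℝ} (ha : ∀ i c, 0 < a i c) (hw : ∀ i, 0 < w i) {r : ℝ} (hr : 0 < r) :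
    dualObjective a (r • w) = dualObjective a w := by
  simp only [dualObjective, minPain_smul a w _ hr.le, ← mul_sum, Pi.smul_apply, smul_eq_mul]
  rw [Real.log_mul hr.ne' (sum_minPain_pos ha hw).ne',
    sum_congr rfl fun i _ => Real.log_mul hr.ne' (hw i).ne', sum_add_distrib, sum_const, card_univ,
    nsmul_eq_mul]
  ring

theorem exists_isMax_dualObjective [Fintype N] [Nonempty N] [Fintype M] [Nonempty M]
    (a : N → M → ℝ) (ha : ∀ i c, 0 < a i c) :
    ∃ w : N → ℝ, (∀ i, 0 < w i) ∧
      ∀ w' : N → ℝ, (∀ i, 0 < w' i) → dualObjective a w' ≤ dualObjective a w := by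
  set C : ℝ := ∑ c, ∑ i, a i c with hC
  set R : ℝ := max 1 (Real.exp (Fintype.card N * Real.log C - dualObjective a 1)) with hR
  have hpos : ∀ w ∈ Set.Icc (1 : N → ℝ) (fun _ => R), ∀ i, 0 < w i := fun w hw i =>
    zero_lt_one.trans_le (hw.1 i)
  have hcont : ContinuousOn (dualObjective a) (Set.Icc 1 fun _ => R) := by
    have hmin : ∀ c, Continuous fun w : N → ℝ => minPain a w c := fun c =>
      Continuous.finset_inf'_apply _ fun i _ => (continuous_apply i).mul continuous_const
    refine (continuousOn_const.mul (ContinuousOn.log ?_ ?_)).sub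
      (continuousOn_finsetSum _ fun i _ => ContinuousOn.log (continuous_apply i).continuousOn ?_)
    · exact (continuous_finsetSum _ fun c _ => hmin c).continuousOn
    · exact fun w hw => (sum_minPain_pos ha (hpos w hw)).ne'
    · exact fun w hw => (hpos w hw i).ne'
  have h1R : (1 : N → ℝ) ∈ Set.Icc (1 : N → ℝ) (fun _ => R) :=
    ⟨le_rfl, fun _ => le_max_left _ _⟩
  obtain ⟨w, hw, hmax⟩ := isCompact_Icc.exists_isMaxOn ⟨_, h1R⟩ hcont
  refine ⟨w, hpos w hw, fun u hu => ?_⟩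
  obtain ⟨m, -, hm⟩ := exists_min_image univ u univ_nonempty
  set y : N → ℝ := (u m)⁻¹ • u with hy
  have hyi : ∀ i, y i = (u m)⁻¹ * u i := fun i => rfl
  have hy1 : ∀ i, 1 ≤ y i := fun i => by
    rw [hyi, inv_mul_eq_div, one_le_div (hu m)]
    exact hm i (mem_univ i)
  have hy0 : ∀ i, 0 < y i := fun i => zero_lt_one.trans_le (hy1 i)
  rw [← dualObjective_smul ha hu (inv_pos.2 (hu m))]
  by_cases hyR : ∀ i, y i ≤ R
  · exact hmax ⟨hy1, hyR⟩
  · push Not at hyR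
    obtain ⟨j, hj⟩ := hyR
    have hle : ∑ c, minPain a y c ≤ C := by
      refine sum_le_sum fun c _ => (minPain_le a y m c).trans ?_
      rw [hyi, inv_mul_cancel₀ (hu m).ne', one_mul]
      exact single_le_sum (f := fun i => a i c) (fun i _ => (ha i c).le) (mem_univ m)
    have hlog : Real.log (∑ c, minPain a y c) ≤ Real.log C :=
      Real.log_le_log (sum_minPain_pos ha hy0) hle
    have hlogR : Fintype.card N * Real.log C - dualObjective a 1 ≤ Real.log (y j) := by
      rw [Real.le_log_iff_exp_le (hy0 j)]
      exact (le_max_right _ _).trans hj.le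
    have hsum : Real.log (y j) ≤ ∑ i, Real.log (y i) :=
      single_le_sum (f := fun i => Real.log (y i)) (fun i _ => Real.log_nonneg (hy1 i))
        (mem_univ j)
    refine le_trans ?_ (hmax h1R)
    have := mul_le_mul_of_nonneg_left hlog (Nat.cast_nonneg (α := ℝ) (Fintype.card N))
    change Fintype.card N * Real.log (∑ c, minPain a y c) - ∑ i, Real.log (y i) ≤ _
    linarith

open Filter Topology in
/-- First-order optimality of the dual objective in the direction `d`. -/
theorem exists_tight_assignment_le [Fintype N] [Nonempty N] [Fintype M] [Nonempty M]
    (a : N → M → ℝ) (ha : ∀ i c, 0 < a i c) (w : N → ℝ) (hw : ∀ i, 0 < w i)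
    (hmax : ∀ w' : N → ℝ, (∀ i, 0 < w' i) → dualObjective a w' ≤ dualObjective a w)
    (d : N → ℝ) :
    ∃ f : M → N, (∀ c, w (f c) * a (f c) c = minPain a w c) ∧
      Fintype.card N * ∑ c, minPain a w c * d (f c) ≤ (∑ c, minPain a w c) * ∑ i, d i := by
  classical
  have htight : ∀ c, ∃ i, w i * a i c = minPain a w c ∧
      ∀ j, w j * a j c = minPain a w c → d i ≤ d j := by
    intro c
    obtain ⟨i, hi, hmin⟩ := exists_min_image {i | w i * a i c = minPain a w c} d
      ((exists_minPain_eq a w c).imp fun i hi => by simpa using hi)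
    exact ⟨i, by simpa using hi, fun j hj => hmin j (by simpa using hj)⟩
  choose f hf hfd using htight
  refine ⟨f, hf, ?_⟩
  set P := ∑ c, minPain a w c with hP
  set D := ∑ c, minPain a w c * d (f c) with hD
  have hP0 : 0 < P := sum_minPain_pos ha hw
  by_contra! hcon
  have hlim : Tendsto (fun t : ℝ => Fintype.card N * D / (P + t * D)) (𝓝[>] 0)
      (𝓝 (Fintype.card N * D / P)) := by
    have : ContinuousAt (fun t : ℝ => Fintype.card N * D / (P + t * D)) 0 := by
      refine ContinuousAt.div (by fun_prop) (by fun_prop) ?_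
      simpa using hP0.ne'
    simpa using this.tendsto.mono_left nhdsWithin_le_nhds
  have hev1 : ∀ᶠ t : ℝ in 𝓝[>] 0, ∑ i, d i < Fintype.card N * D / (P + t * D) :=
    hlim.eventually_const_lt ((lt_div_iff₀' hP0).2 hcon)
  have hpos : ∀ r s : ℝ, 0 < r → ∀ᶠ t : ℝ in 𝓝[>] 0, 0 < r + t * s := by
    intro r s hr
    have : ContinuousAt (fun t : ℝ => r + t * s) 0 := by fun_prop
    exact (this.tendsto.mono_left nhdsWithin_le_nhds).eventually_const_lt (by simpa using hr)
  have hev2 : ∀ᶠ t : ℝ in 𝓝[>] 0, ∀ i, 0 < 1 + t * d i :=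
    eventually_all.2 fun i => hpos _ _ one_pos
  have hev3 : ∀ᶠ t : ℝ in 𝓝[>] 0, ∀ c i,
      minPain a w c * (1 + t * d (f c)) ≤ w i * (1 + t * d i) * a i c := by
    refine eventually_all.2 fun c => eventually_all.2 fun i => ?_
    rcases (minPain_le a w i c).eq_or_lt with h | h
    · filter_upwards [self_mem_nhdsWithin] with t ht
      have h1 := mul_le_mul_of_nonneg_left (hfd c i h.symm) (le_of_lt (Set.mem_Ioi.1 ht))
      have h2 := mul_le_mul_of_nonneg_left h1 (minPain_pos ha hw c).le
      have h3 : w i * (1 + t * d i) * a i c = minPain a w c * (1 + t * d i) := by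
        rw [h]; ring
      linarith
    · filter_upwards [hpos _ (w i * a i c * d i - minPain a w c * d (f c)) (sub_pos.2 h)]
        with t ht
      linarith
  obtain ⟨t, h1, h2, h3, h4, ht⟩ := (hev1.and (hev2.and (hev3.and
    ((hpos P D hP0).and self_mem_nhdsWithin)))).exists
  have ht0 : 0 < t := ht
  have hopt := hmax (fun i => w i * (1 + t * d i)) fun i => mul_pos (hw i) (h2 i)
  have hge : P + t * D ≤ ∑ c, minPain a (fun i => w i * (1 + t * d i)) c := by
    have : P + t * D = ∑ c, minPain a w c * (1 + t * d (f c)) := by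
      rw [hP, hD, mul_sum, ← sum_add_distrib]
      exact sum_congr rfl fun c _ => by ring
    rw [this]
    exact sum_le_sum fun c _ => le_minPain (h3 c)
  have hlogs : ∑ i, Real.log (w i * (1 + t * d i)) ≤ ∑ i, Real.log (w i) + t * ∑ i, d i := by
    rw [mul_sum, ← sum_add_distrib]
    refine sum_le_sum fun i _ => ?_
    rw [Real.log_mul (hw i).ne' (h2 i).ne']
    linarith [Real.log_le_sub_one_of_pos (h2 i)]
  have hlog := Real.log_le_log h4 hge
  have hratio := Real.one_sub_inv_le_log_of_pos (div_pos h4 hP0)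
  rw [Real.log_div h4.ne' hP0.ne', inv_div] at hratio
  have hN := Nat.cast_nonneg (α := ℝ) (Fintype.card N)
  have hkey : Fintype.card N * (1 - P / (P + t * D)) ≤ t * ∑ i, d i := by
    have h5 := mul_le_mul_of_nonneg_left (hratio.trans (sub_le_sub_right hlog _)) hN
    simp only [dualObjective] at hopt
    rw [mul_sub _ (Real.log _)] at h5
    linarith
  have heq : Fintype.card N * (1 - P / (P + t * D)) = t * (Fintype.card N * D / (P + t * D)) := by
    field_simp
    ring
  rw [heq] at hkey
  exact absurd (le_of_mul_le_mul_left hkey ht0) h1.not_ge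

/-- Competitive equilibrium from equal incomes for divisible chores: some positive weights admit a
fractional assignment to cheapest agents in which all agents earn the same. -/
theorem exists_equal_earnings [Fintype N] [Nonempty N] [Fintype M] [Nonempty M]
    (a : N → M → ℝ) (ha : ∀ i c, 0 < a i c) :
    ∃ (w : N → ℝ) (x : N → M → ℝ) (r : ℝ), (∀ i, 0 < w i) ∧ (∀ i c, 0 ≤ x i c) ∧
      (∀ c, ∑ i, x i c = 1) ∧ (∀ i c, x i c ≠ 0 → w i * a i c = minPain a w c) ∧
      ∀ i, ∑ c, minPain a w c * x i c = r := by
  classical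
  obtain ⟨w, hw, hmax⟩ := exists_isMax_dualObjective a ha
  set P := ∑ c, minPain a w c with hP
  set F : Set (M → N) := {f | ∀ c, w (f c) * a (f c) c = minPain a w c} with hF
  set load : (M → N) → N → ℝ := fun f i => ∑ c, minPain a w c * (if f c = i then 1 else 0)
    with hload
  set X : Set (N → M → ℝ) := {x | (∀ i c, 0 ≤ x i c) ∧ (∀ c, ∑ i, x i c = 1) ∧
    ∀ i c, w i * a i c ≠ minPain a w c → x i c = 0} with hX
  set L : (N → M → ℝ) → N → ℝ := fun x i => ∑ c, minPain a w c * x i c with hL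
  have hXconv : Convex ℝ X := by
    rintro x ⟨hx0, hx1, hxT⟩ y ⟨hy0, hy1, hyT⟩ s t hs ht hst
    refine ⟨fun i c => ?_, fun c => ?_, fun i c h => ?_⟩
    · exact add_nonneg (mul_nonneg hs (hx0 i c)) (mul_nonneg ht (hy0 i c))
    · simp [sum_add_distrib, ← mul_sum, hx1, hy1, hst]
    · simp [hxT i c h, hyT i c h]
  have hLlin : IsLinearMap ℝ L :=
    { map_add := fun x y => by ext i; simp [hL, mul_add, sum_add_distrib]
      map_smul := fun t x => by ext i; simp [hL, mul_sum, mul_left_comm] }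
  have hsub : convexHull ℝ (load '' F) ⊆ L '' X := by
    refine convexHull_min ?_ (hXconv.is_linear_image hLlin)
    rintro _ ⟨f, hf, rfl⟩
    refine ⟨fun i c => if f c = i then 1 else 0, ⟨fun i c => ?_, fun c => ?_, fun i c h => ?_⟩, rfl⟩
    · dsimp only
      split_ifs <;> simp
    · simp
    · refine if_neg ?_
      rintro rfl
      exact h (hf c)
  have hmem : (fun _ => P / Fintype.card N : N → ℝ) ∈ convexHull ℝ (load '' F) := by
    by_contra hnot
    obtain ⟨g, u, hgu, hu⟩ := geometric_hahn_banach_point_closed (convex_convexHull ℝ _)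
      ((Set.toFinite (load '' F)).isClosed_convexHull ℝ) hnot
    set d : N → ℝ := fun i => g (Pi.single i 1) with hd
    have hg : ∀ y, g y = ∑ i, y i * d i := fun y => by
      have := LinearMap.pi_apply_eq_sum_univ (g : (N → ℝ) →ₗ[ℝ] ℝ) y
      simp only [ContinuousLinearMap.coe_coe, smul_eq_mul] at this
      rw [this]
      refine sum_congr rfl fun i _ => ?_
      congr 2
      ext j
      simp [Pi.single_apply, eq_comm]
    obtain ⟨f, hf, hfd⟩ := exists_tight_assignment_le a ha w hw hmax d
    have hlt := hgu.trans (hu _ (subset_convexHull ℝ _ ⟨f, hf, rfl⟩))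
    have hfg : g (load f) = ∑ c, minPain a w c * d (f c) := by
      rw [hg]
      simp only [hload, sum_mul]
      rw [sum_comm]
      simp
    rw [hfg, hg, ← mul_sum, div_mul_eq_mul_div, div_lt_iff₀' (by exact_mod_cast Fintype.card_pos)]
      at hlt
    exact absurd hfd hlt.not_ge
  obtain ⟨x, ⟨hx0, hx1, hxT⟩, hx⟩ := hsub hmem
  exact ⟨w, x, _, hw, hx0, hx1, fun i c h => by
    by_contra h'
    exact h (hxT i c h'), fun i => congrFun hx i⟩

theorem sum_sum_of_isAllocation [Fintype N] [Fintype M] [DecidableEq M] {A : N → Finset M}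
    (hA : IsAllocation A) (p : M → ℝ) : ∑ i, ∑ c ∈ A i, p c = ∑ c, p c := by
  rw [← sum_biUnion fun i _ j _ hij => hA.1 i j hij]
  congr 1
  ext c
  simpa using hA.2 c

/-- An allocation of every chore to a cheapest agent, for positive weights, is Pareto optimal. -/
theorem paretoOptimal_of_weights [Fintype N] [Fintype M] [DecidableEq M] {v : N → M → ℤ}
    {A : N → Finset M} (hA : IsAllocation A) (w : N → ℝ) (p : M → ℝ) (hw : ∀ i, 0 < w i)
    (hle : ∀ i c, p c ≤ w i * -(v i c : ℝ)) (heq : ∀ i, ∀ c ∈ A i, w i * -(v i c : ℝ) = p c) :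
    ParetoOptimal v A := by
  rintro ⟨B, hB, hge, j, hj⟩
  have hval : ∀ i (S : Finset M), w i * (val (v i) S : ℝ) = -∑ c ∈ S, w i * -(v i c : ℝ) := by
    intro i S
    simp [_root_.val, mul_sum]
  have hlt : ∑ i, w i * (val (v i) (A i) : ℝ) < ∑ i, w i * (val (v i) (B i) : ℝ) :=
    sum_lt_sum (fun i _ => mul_le_mul_of_nonneg_left (by exact_mod_cast hge i) (hw i).le)
      ⟨j, mem_univ j, mul_lt_mul_of_pos_left (by exact_mod_cast hj) (hw j)⟩
  have hAsum : ∑ i, w i * (val (v i) (A i) : ℝ) = -∑ c, p c := by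
    rw [← sum_sum_of_isAllocation hA p, ← sum_neg_distrib]
    exact sum_congr rfl fun i _ => by rw [hval, sum_congr rfl (heq i)]
  have hBsum : ∑ i, w i * (val (v i) (B i) : ℝ) ≤ -∑ c, p c := by
    rw [← sum_sum_of_isAllocation hB p, ← sum_neg_distrib]
    exact sum_le_sum fun i _ => by
      rw [hval]
      exact neg_le_neg (sum_le_sum fun c _ => hle i c)
  linarith

theorem def_of_price_spread [Fintype N] [Nonempty N] [Fintype M] [DecidableEq M]
    {v : N → M → ℤ} {A : N → Finset M} (w : N → ℝ) (p : M → ℝ) (hw : ∀ i, 0 < w i)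
    (hle : ∀ i c, p c ≤ w i * -(v i c : ℝ)) (heq : ∀ i, ∀ c ∈ A i, w i * -(v i c : ℝ) = p c)
    (b : M) (hspread : ∀ i h, ∑ c ∈ A i, p c ≤ ∑ c ∈ A h, p c + 2 * p b) :
    DEF v A (2 * Fintype.card N - 2) := by
  classical
  obtain ⟨m, -, hm⟩ := exists_max_image univ (fun i => ∑ c ∈ A i, p c) univ_nonempty
  refine ⟨fun h => if h = m then 0 else Multiset.replicate 2 b, ?_, fun i h _ => ?_⟩
  · have hcard : ∀ h : N, Multiset.card (if h = m then 0 else Multiset.replicate 2 b) =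
        if h = m then 0 else 2 := fun h => by split_ifs <;> simp
    simp only [hcard]
    rw [← add_sum_erase univ _ (mem_univ m), if_pos rfl, zero_add,
      sum_congr rfl fun h hh => if_neg (ne_of_mem_erase hh), sum_const,
      card_erase_of_mem (mem_univ m), card_univ, smul_eq_mul]
    omega
  · have hval : ∀ S : Finset M, w i * (val (v i) S : ℝ) = -∑ c ∈ S, w i * -(v i c : ℝ) := by
      intro S
      simp [_root_.val, mul_sum]
    have hi : w i * (val (v i) (A i) : ℝ) = -∑ c ∈ A i, p c := by
      rw [hval, sum_congr rfl (heq i)]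
    have hh : w i * (val (v i) (A h) : ℝ) ≤ -∑ c ∈ A h, p c := by
      rw [hval]
      exact neg_le_neg (sum_le_sum fun c _ => hle i c)
    by_cases hhm : h = m
    · subst hhm
      have hreal : (val (v i) (A h) : ℝ) ≤ val (v i) (A i) :=
        le_of_mul_le_mul_left (by linarith [hm i (mem_univ i)]) (hw i)
      simpa using (by exact_mod_cast hreal : val (v i) (A h) ≤ val (v i) (A i))
    · have hreal : (val (v i) (A h) + 2 * v i b : ℝ) ≤ val (v i) (A i) :=
        le_of_mul_le_mul_left (by linarith [hspread i h, hle i b]) (hw i)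
      simpa [hhm, two_mul] using
        (by exact_mod_cast hreal : val (v i) (A h) + 2 * v i b ≤ val (v i) (A i))

/-- for every chores instance with strictly negative valuations, there
exists a DEF-(2n-2) and Pareto optimal allocation. -/
theorem exists_def_two_n_sub_two_and_po {n : ℕ} (hn : 0 < n)
    {M : Type*} [Fintype M] [DecidableEq M]
    (v : Fin n → M → ℤ) (hv : ∀ i c, v i c < 0) :
    ∃ A : Fin n → Finset M, IsAllocation A ∧ DEF v A (2 * n - 2) ∧ ParetoOptimal v A := by
  rcases isEmpty_or_nonempty M with hM | hM
  · refine ⟨fun _ => ∅, ⟨by simp, fun c => isEmptyElim c⟩, ⟨fun _ => 0, by simp, by simp⟩, ?_⟩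
    rintro ⟨B, -, -, j, hj⟩
    simp [Finset.eq_empty_of_isEmpty] at hj
  have : Nonempty (Fin n) := ⟨⟨0, hn⟩⟩
  have ha : ∀ i c, 0 < -(v i c : ℝ) := fun i c => neg_pos.2 (by exact_mod_cast hv i c)
  obtain ⟨w, x, r, hw, hx0, hx1, hxT, hxr⟩ := exists_equal_earnings (fun i c => -(v i c : ℝ)) ha
  set p := minPain (fun i c => -(v i c : ℝ)) w
  have hp : ∀ c, 0 < p c := minPain_pos ha hw
  obtain ⟨b, -, hb⟩ := exists_max_image univ p univ_nonempty
  obtain ⟨f, hf, hfr⟩ := exists_rounding_of_active p (p b) (fun c => (hp c).le) (hp b).le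
    (fun c => hb c (mem_univ c)) _ univ x le_rfl hx0 hx1
  have hA : IsAllocation fun i => ({c | f c = i} : Finset M) := by
    refine ⟨fun i j hij => ?_, fun c => ⟨f c, by simp⟩⟩
    rw [Finset.disjoint_filter]
    rintro c - rfl
    exact hij
  have hle : ∀ i c, p c ≤ w i * -(v i c : ℝ) := minPain_le _ w
  have heq : ∀ i, ∀ c ∈ ({c | f c = i} : Finset M), w i * -(v i c : ℝ) = p c := by
    intro i c hc
    obtain rfl : f c = i := by simpa using hc
    exact hxT _ c (hf c)
  refine ⟨_, hA, ?_, paretoOptimal_of_weights hA w p hw hle heq⟩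
  have hload : ∀ i, |∑ c ∈ ({c | f c = i} : Finset M), p c - r| ≤ p b := fun i => by
    have := hfr i (mem_univ i)
    rw [hxr] at this
    simpa [sum_filter] using this
  have hDEF := def_of_price_spread (A := fun i => ({c | f c = i} : Finset M)) w p hw hle heq b
    fun i h => by linarith [(abs_le.1 (hload i)).2, (abs_le.1 (hload h)).1]
  rwa [Fintype.card_fin] at hDEF
end

section
/- For every chores instance with n agents and binary valuations, i.e. v_i(c) ∈ {-1, 0} for every agent i and chore c, there exists an allocation that is both DEF-(n-1) and Pareto optimal. -/
open Finset

variable {N M : Type*}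

/-- Any finite set can be distributed over a nonempty finite type so that any two fibers
differ in cardinality by at most one. -/
theorem exists_balanced_map [Fintype N] [Nonempty N] [DecidableEq N]
    [DecidableEq M] (S : Finset M) :
    ∃ f : M → N, ∀ i h : N, #{c ∈ S | f c = i} ≤ #{c ∈ S | f c = h} + 1 := by
  induction S using Finset.induction_on with
  | empty => exact ⟨fun _ => Classical.arbitrary N, by simp⟩
  | insert a S ha ih =>
    obtain ⟨f, hf⟩ := ih
    obtain ⟨m, -, hm⟩ := exists_min_image (univ : Finset N) (fun i => #{c ∈ S | f c = i})
      univ_nonempty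
    refine ⟨Function.update f a m, ?_⟩
    have key (i : N) : #{c ∈ insert a S | Function.update f a m c = i} =
        #{c ∈ S | f c = i} + if m = i then 1 else 0 := by
      have hS : {c ∈ S | Function.update f a m c = i} = {c ∈ S | f c = i} := by
        refine filter_congr fun c hc => ?_
        rw [Function.update_of_ne (ne_of_mem_of_not_mem hc ha)]
      rw [filter_insert, hS, Function.update_self]
      split_ifs
      · rw [card_insert_of_notMem (by simp [ha])]
      · rfl
    intro i h
    rw [key, key]
    have h₁ := hf i h
    have h₂ := hm h (mem_univ _)
    split_ifs with hi hh
    · omega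
    · subst hi; omega
    · omega
    · omega

/-- A bundle is worth at most minus the number of its chores that the agent dislikes. -/
theorem val_le_neg_card_filter (v : M → ℤ) (P : M → Prop) [DecidablePred P]
    (hv : ∀ c, v c ≤ 0) (hP : ∀ c, P c → v c = -1) (S : Finset M) :
    val v S ≤ -(#{c ∈ S | P c} : ℤ) := by
  rw [_root_.val, card_filter, Nat.cast_sum, ← sum_neg_distrib]
  refine sum_le_sum fun c _ => ?_
  by_cases hc : P c
  · simp [hc, hP c hc]
  · simpa [hc] using hv c

theorem val_eq_neg_card_filter (v : M → ℤ) (P : M → Prop) [DecidablePred P]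
    (S : Finset M) (hP : ∀ c ∈ S, P c → v c = -1) (hP' : ∀ c ∈ S, ¬ P c → v c = 0) :
    val v S = -(#{c ∈ S | P c} : ℤ) := by
  rw [_root_.val, card_filter, Nat.cast_sum, ← sum_neg_distrib]
  refine sum_congr rfl fun c hcS => ?_
  by_cases hc : P c
  · simp [hc, hP c hcS hc]
  · simpa [hc] using hP' c hcS hc

/-- for every chores instance with binary valuations (values in {-1,0})
there exists a DEF-(n-1) and Pareto optimal allocation. -/
theorem binary_valuations_exists_def_po {n : ℕ} (hn : 0 < n)
    {M : Type*} [Fintype M] [DecidableEq M]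
    (v : Fin n → M → ℤ) (hv : ∀ i c, v i c = -1 ∨ v i c = 0) :
    ∃ A : Fin n → Finset M, IsAllocation A ∧ DEF v A (n - 1) ∧ ParetoOptimal v A := by
  have : Nonempty (Fin n) := ⟨⟨0, hn⟩⟩
  -- chores disliked by everyone are spread evenly, the others go to indifferent agents
  let P : M → Prop := fun c => ∀ i, v i c = -1
  have : DecidablePred P := Classical.decPred P
  have hv0 (i : Fin n) (c : M) : v i c ≤ 0 := by rcases hv i c with h | h <;> omega
  have hz (c : M) : ∃ i, ¬ P c → v i c = 0 := by
    by_cases hc : P c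
    · exact ⟨⟨0, hn⟩, fun h => absurd hc h⟩
    · obtain ⟨i, hi⟩ := not_forall.1 hc
      exact ⟨i, fun _ => (hv i c).resolve_left hi⟩
  choose z hz using hz
  obtain ⟨f, hf⟩ := exists_balanced_map (N := Fin n) ({c | P c} : Finset M)
  let A : Fin n → Finset M := fun i => {c | (if P c then f c else z c) = i}
  let b : Fin n → ℕ := fun i => #{c ∈ A i | P c}
  have hb (i : Fin n) : b i = #{c ∈ ({c | P c} : Finset M) | f c = i} := by
    refine congrArg card (Finset.ext fun c => ?_)
    by_cases hc : P c <;> simp [A, hc]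
  have hA (i : Fin n) : val (v i) (A i) = -(b i : ℤ) := by
    refine val_eq_neg_card_filter _ P _ (fun c _ hc => hc i) fun c hcA hc => ?_
    have hzi : z c = i := by simpa [A, hc] using hcA
    exact hzi ▸ hz c hc
  have hle (i : Fin n) (S : Finset M) : val (v i) S ≤ -(#{c ∈ S | P c} : ℤ) :=
    val_le_neg_card_filter _ P (hv0 i) (fun c hc => hc i) S
  refine ⟨A, ⟨fun i j hij => ?_, fun c => ⟨_, by simp [A]; rfl⟩⟩, ?_, ?_⟩
  · rw [disjoint_left]
    intro c hi hj
    simp only [A, mem_filter, mem_univ, true_and] at hi hj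
    exact hij (hi.symm.trans hj)
  · obtain ⟨m, -, hm⟩ := exists_max_image (univ : Finset (Fin n)) b univ_nonempty
    by_cases hB : ∃ c, P c
    · obtain ⟨c, hc⟩ := hB
      refine ⟨fun h => if b h < b m then {c} else 0, ?_, fun i h _ => ?_⟩
      · have hcard : ∑ h, Multiset.card (if b h < b m then ({c} : Multiset M) else 0) =
            #{h | b h < b m} := by
          rw [card_filter]
          refine sum_congr rfl fun h _ => ?_
          split_ifs <;> simp
        rw [hcard]
        have hsub : ({h | b h < b m} : Finset (Fin n)) ⊆ univ.erase m := by
          intro h hh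
          simp only [mem_filter, mem_univ, true_and] at hh
          simpa using fun e : h = m => absurd hh (by simp [e])
        simpa using card_le_card hsub
      · have h₁ := hle i (A h)
        have h₂ := hm i (mem_univ i)
        have h₃ : b i ≤ b h + 1 := by simpa only [hb] using hf i h
        change val (v i) (A h) ≤ -(b h : ℤ) at h₁
        rw [hA]
        dsimp only
        split_ifs with hlt
        · simp only [Multiset.map_singleton, Multiset.sum_singleton, hc i]
          omega
        · simp only [Multiset.map_zero, Multiset.sum_zero]
          omega
    · refine ⟨fun _ => 0, by simp, fun i h _ => ?_⟩
      have hbi : b i = 0 := by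
        refine card_eq_zero.2 (filter_eq_empty_iff.2 fun c _ hc => hB ⟨c, hc⟩)
      have h₁ := hle i (A h)
      rw [hA, hbi]
      simp only [Multiset.map_zero, Multiset.sum_zero]
      omega
  · rintro ⟨B, ⟨-, hBcov⟩, hge, j, hj⟩
    have hlt : ∑ i, val (v i) (A i) < ∑ i, val (v i) (B i) :=
      sum_lt_sum (fun i _ => hge i) ⟨j, mem_univ j, hj⟩
    have hsumA : ∑ i, b i = #({c | P c} : Finset M) := by
      simp only [hb]
      exact (card_eq_sum_card_fiberwise fun c _ => mem_univ (f c)).symm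
    have hsumB : #({c | P c} : Finset M) ≤ ∑ i, #{c ∈ B i | P c} := by
      refine (card_le_card fun c hc => ?_).trans card_biUnion_le
      obtain ⟨i, hi⟩ := hBcov c
      exact mem_biUnion.2 ⟨i, mem_univ i, mem_filter.2 ⟨hi, (mem_filter.1 hc).2⟩⟩
    have hleB : ∑ i, val (v i) (B i) ≤ -((∑ i, #{c ∈ B i | P c} : ℕ) : ℤ) := by
      rw [Nat.cast_sum, ← sum_neg_distrib]
      exact sum_le_sum fun i _ => hle i (B i)
    have heqA : ∑ i, val (v i) (A i) = -((∑ i, b i : ℕ) : ℤ) := by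
      rw [Nat.cast_sum, ← sum_neg_distrib]
      exact sum_congr rfl fun i _ => hA i
    omega
end

section
/- For every chores instance with n agents and bivalued valuations, i.e. there exist integers x < y < 0 such that v_i(c) ∈ {x, y} for every agent i and chore c, there exists an allocation that is both DEF-(n-1) and Pareto optimal. -/
open Finset

variable {N M : Type*}

section Tally

variable [DecidableEq N] [Fintype M]

/-- The chores owned by agent `i` under the ownership function `f`. -/
def bundle (f : M → N) (i : N) : Finset M := univ.filter (fun c => f c = i)

@[simp] lemma mem_bundle {f : M → N} {i : N} {c : M} : c ∈ bundle f i ↔ f c = i := by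
  simp [bundle]

/-- The sum over the chores owned by `i` of a quantity that depends on owner and chore. -/
def tally (g : N → M → ℤ) (f : M → N) (i : N) : ℤ := ∑ c ∈ bundle f i, g i c

lemma tally_congr {g g' : N → M → ℤ} {f : M → N} {i : N}
    (h : ∀ c, f c = i → g i c = g' i c) : tally g f i = tally g' f i :=
  Finset.sum_congr rfl fun c hc => h c (mem_bundle.1 hc)

lemma tally_nonneg {g : N → M → ℤ} {f : M → N} {i : N} (h : ∀ c, 0 ≤ g i c) :
    0 ≤ tally g f i :=
  Finset.sum_nonneg fun c _ => h c

lemma tally_update [DecidableEq M] (g : N → M → ℤ) (f : M → N) (c : M) (s t : N) :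
    tally g (Function.update f c s) t =
      tally g f t + (if t = s then g t c else 0) - (if t = f c then g t c else 0) := by
  have key : ∀ d : M, (if Function.update f c s d = t then g t d else 0) =
      (if f d = t then g t d else 0) +
        (if d = c then (if t = s then g t c else 0) - (if t = f c then g t c else 0) else 0) := by
    intro d
    by_cases hd : d = c
    · subst hd
      simp only [Function.update_self, if_true, eq_comm (a := t)]
      ring
    · simp [hd]
  simp only [tally, bundle, Finset.sum_filter]
  rw [Finset.sum_congr rfl fun d _ => key d, Finset.sum_add_distrib]
  simp only [Finset.sum_ite_eq', Finset.mem_univ, if_true]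
  ring

/-- The total cost of the chores owned by `i`. -/
abbrev load (w : N → M → ℤ) (f : M → N) (i : N) : ℤ := tally w f i

/-- The number of chores owned by `i`. -/
abbrev count (f : M → N) (i : N) : ℤ := tally (fun _ _ => 1) f i

/-- The number of chores owned by `i` that have cost `b` for `i`. -/
abbrev easy (b : ℤ) (w : N → M → ℤ) (f : M → N) (i : N) : ℤ :=
  tally (fun i c => if w i c = b then 1 else 0) f i

lemma easy_nonneg (b : ℤ) (w : N → M → ℤ) (f : M → N) (i : N) : 0 ≤ easy b w f i :=
  tally_nonneg fun c => by split_ifs <;> norm_num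

lemma load_eq_of_forall_easy {b : ℤ} {w : N → M → ℤ} {f : M → N} {i : N}
    (h : ∀ c, f c = i → w i c = b) : load w f i = b * count f i := by
  rw [load, tally_congr (g' := fun _ _ => b) h]
  simp [tally, mul_comm]

lemma easy_eq_of_forall_easy {b : ℤ} {w : N → M → ℤ} {f : M → N} {i : N}
    (h : ∀ c, f c = i → w i c = b) : easy b w f i = count f i :=
  tally_congr fun c hc => by simp [h c hc]

variable {a b : ℤ} {w : N → M → ℤ} (hab : b < a) (hb : 0 < b)
  (hw : ∀ i c, w i c = a ∨ w i c = b)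

include hab hb hw

lemma easy_le_load (f : M → N) (i : N) : b * easy b w f i ≤ load w f i := by
  simp only [tally, Finset.mul_sum]
  refine Finset.sum_le_sum fun c _ => ?_
  rcases hw i c with h | h <;> rw [h] <;> split_ifs <;> omega

lemma easy_add_le_load {f : M → N} {c : M} (hc : w (f c) c = a) :
    b * easy b w f (f c) + a ≤ load w f (f c) := by
  have hmem : c ∈ bundle f (f c) := mem_bundle.2 rfl
  classical
  simp only [tally, Finset.mul_sum]
  rw [← Finset.add_sum_erase _ _ hmem, ← Finset.add_sum_erase _ _ hmem]
  have : ∑ d ∈ (bundle f (f c)).erase c, b * (if w (f c) d = b then 1 else 0) ≤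
      ∑ d ∈ (bundle f (f c)).erase c, w (f c) d := by
    refine Finset.sum_le_sum fun d _ => ?_
    rcases hw (f c) d with h | h <;> rw [h] <;> split_ifs <;> omega
  rw [hc, if_neg hab.ne']
  linarith

end Tally

section Market

lemma IsAllocation.sum_sum [Fintype N] [Fintype M] [DecidableEq M] {B : N → Finset M}
    (hB : IsAllocation B) (p : M → ℤ) :
    ∑ i, ∑ c ∈ B i, p c = ∑ c, p c := by
  rw [← Finset.sum_biUnion fun i _ j _ hij => hB.1 i j hij]
  refine Finset.sum_congr (Finset.eq_univ_iff_forall.2 fun c => ?_) fun _ _ => rfl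
  simpa using hB.2 c

variable [DecidableEq N] [Fintype M]

lemma isAllocation_bundle [DecidableEq M] (f : M → N) : IsAllocation (bundle f) := by
  refine ⟨fun i j hij => Finset.disjoint_left.2 fun c hi hj => hij ?_, fun c => ⟨f c, by simp⟩⟩
  rw [← mem_bundle.1 hi, ← mem_bundle.1 hj]

variable [Fintype N]

/-- If every chore is owned by an agent of minimal weighted cost, the allocation is
Pareto optimal. -/
lemma paretoOptimal_of_prices [DecidableEq M] {v : N → M → ℤ} {f : M → N} {u : N → ℤ} {p : M → ℤ}
    (hu : ∀ i, 0 < u i) (hown : ∀ c, u (f c) * -v (f c) c = p c)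
    (hle : ∀ j c, p c ≤ u j * -v j c) : ParetoOptimal v (bundle f) := by
  rintro ⟨B, hB, hge, j, hj⟩
  have h1 : ∑ i, u i * val (v i) (bundle f i) < ∑ i, u i * val (v i) (B i) :=
    Finset.sum_lt_sum (fun i _ => mul_le_mul_of_nonneg_left (hge i) (hu i).le)
      ⟨j, Finset.mem_univ j, mul_lt_mul_of_pos_left hj (hu j)⟩
  have h2 : ∑ i, u i * val (v i) (bundle f i) = -∑ c, p c := by
    rw [← (isAllocation_bundle f).sum_sum p, ← Finset.sum_neg_distrib]
    refine Finset.sum_congr rfl fun i _ => ?_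
    rw [_root_.val, Finset.mul_sum, ← Finset.sum_neg_distrib]
    refine Finset.sum_congr rfl fun c hc => ?_
    have := hown c
    rw [mem_bundle.1 hc] at this
    linarith
  have h3 : ∑ i, u i * val (v i) (B i) ≤ -∑ c, p c := by
    rw [← hB.sum_sum p, ← Finset.sum_neg_distrib]
    refine Finset.sum_le_sum fun i _ => ?_
    rw [_root_.val, Finset.mul_sum, ← Finset.sum_neg_distrib]
    refine Finset.sum_le_sum fun c _ => ?_
    linarith [hle i c]
  linarith

/-- If the prices of any two bundles of a market equilibrium differ by at most the price of
one chore, then one dubious copy of it for all but the richest agent removes all envy. -/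
lemma def_of_prices [Nonempty N] {v : N → M → ℤ} {f : M → N} {u : N → ℤ} {p : M → ℤ}
    (hu : ∀ i, 0 < u i) (hown : ∀ c, u (f c) * -v (f c) c = p c)
    (hle : ∀ j c, p c ≤ u j * -v j c) (c₀ : M)
    (hp : ∀ i h, tally (fun _ => p) f i ≤ tally (fun _ => p) f h + p c₀) :
    DEF v (bundle f) (Fintype.card N - 1) := by
  obtain ⟨r, hr⟩ := Finite.exists_max (tally (fun _ => p) f)
  refine ⟨fun h => if h = r then 0 else {c₀}, ?_, fun i h _ => ?_⟩
  · have : ∀ h : N, Multiset.card (if h = r then (0 : Multiset M) else {c₀}) =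
        if h ≠ r then 1 else 0 := fun h => by split_ifs <;> simp_all
    simp only [this]
    rw [← Finset.card_filter, Finset.filter_ne', Finset.card_erase_of_mem (Finset.mem_univ r),
      Finset.card_univ]
  · have h1 : u i * val (v i) (bundle f i) = -tally (fun _ => p) f i := by
      rw [_root_.val, tally, Finset.mul_sum, ← Finset.sum_neg_distrib]
      refine Finset.sum_congr rfl fun c hc => ?_
      have := hown c
      rw [mem_bundle.1 hc] at this
      linarith
    have h2 : u i * val (v i) (bundle f h) ≤ -tally (fun _ => p) f h := by
      rw [_root_.val, tally, Finset.mul_sum, ← Finset.sum_neg_distrib]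
      exact Finset.sum_le_sum fun c _ => by linarith [hle i c]
    refine le_of_mul_le_mul_left ?_ (hu i)
    beta_reduce
    split_ifs with hh
    · subst hh
      simp only [Multiset.map_zero, Multiset.sum_zero, add_zero]
      linarith [hr i]
    · simp only [Multiset.map_singleton, Multiset.sum_singleton, mul_add]
      linarith [hp i h, hle i c₀]

end Market

section Balance

variable [DecidableEq N]

lemma sum_sq_transfer [Fintype N] {g g' : N → ℤ} {d : ℤ} {i j : N} (hij : i ≠ j)
    (h : ∀ t, g' t = g t + (if t = j then d else 0) - (if t = i then d else 0)) :
    ∑ t, g' t ^ 2 = ∑ t, g t ^ 2 + 2 * d * (g j - g i + d) := by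
  have key : ∀ t, g' t ^ 2 = g t ^ 2 + (if t = j then 2 * d * g j + d ^ 2 else 0) +
      (if t = i then d ^ 2 - 2 * d * g i else 0) := by
    intro t
    rw [h t]
    by_cases h1 : t = j
    · subst h1
      simp only [if_true, if_neg hij.symm]
      ring
    · by_cases h2 : t = i
      · subst h2
        simp only [if_true, if_neg h1]
        ring
      · simp [h1, h2]
  rw [Finset.sum_congr rfl fun t _ => key t, Finset.sum_add_distrib, Finset.sum_add_distrib]
  simp only [Finset.sum_ite_eq', Finset.mem_univ, if_true]
  ring

/-- Every chore that is cheap for somebody is owned by an agent for whom it is cheap. -/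
def CheapOwned (b : ℤ) (w : N → M → ℤ) (f : M → N) : Prop :=
  ∀ c, (∃ j, w j c = b) → w (f c) c = b

/-- `j` is reachable from `i` in `n` steps, where each step goes from the owner of a chore
to another agent for whom that chore is cheap too. -/
def Reach (b : ℤ) (w : N → M → ℤ) (f : M → N) (i : N) : ℕ → N → Prop
  | 0, j => i = j
  | n + 1, j => ∃ k, Reach b w f i n k ∧ ∃ c, f c = k ∧ w k c = b ∧ w j c = b

variable [Fintype M] [DecidableEq M] {a b : ℤ} {w : N → M → ℤ}

lemma Reach.exists_transfer {i : N} (n : ℕ) : ∀ {f : M → N} {j : N}, CheapOwned b w f →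
    Reach b w f i n j → ∃ f', CheapOwned b w f' ∧ ∀ t, easy b w f' t =
      easy b w f t + (if t = j then 1 else 0) - (if t = i then 1 else 0) := by
  classical
  induction n using Nat.strong_induction_on with
  | _ n ih =>
  intro f j hf hr
  cases n with
  | zero =>
    have hij : i = j := hr
    subst hij
    exact ⟨f, hf, fun t => by ring⟩
  | succ n =>
    obtain ⟨k, hk, c, hck, hkc, hjc⟩ := hr
    have hex : ∃ m, Reach b w f i m k := ⟨n, hk⟩
    have hmn : Nat.find hex ≤ n := Nat.find_min' hex hk
    have hf1 : CheapOwned b w (Function.update f c j) := by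
      intro d hd
      by_cases hdc : d = c
      · subst hdc
        simpa using hjc
      · simpa [hdc] using hf d hd
    have step : ∀ m ≤ Nat.find hex, ∀ z, Reach b w f i m z →
        Reach b w (Function.update f c j) i m z := by
      intro m
      induction m with
      | zero => exact fun _ z hz => hz
      | succ m ihm =>
        rintro hm z ⟨y, hy, d, hdy, hyd, hzd⟩
        refine ⟨y, ihm (by omega) y hy, d, ?_, hyd, hzd⟩
        have hdc : d ≠ c := by
          rintro rfl
          rw [hck] at hdy
          subst hdy
          exact Nat.find_min hex (show m < _ by omega) hy
        simpa [hdc] using hdy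
    obtain ⟨f', hf', he⟩ := ih (Nat.find hex) (by omega) hf1
      (step _ le_rfl k (Nat.find_spec hex))
    refine ⟨f', hf', fun t => ?_⟩
    rw [he t, easy, tally_update, hck]
    by_cases h1 : t = j
    · subst h1
      by_cases h2 : t = k
      · subst h2
        simp [hkc]
      · simp [hjc, h2]
    · by_cases h2 : t = k
      · subst h2
        simp [hkc, h1]
      · simp [h1, h2]

/-- There is an ownership function that balances first the numbers of cheap chores and then
the loads. -/
lemma exists_balanced [Fintype N] [Nonempty N] (hab : b < a) (hb : 0 < b)
    (hw : ∀ i c, w i c = a ∨ w i c = b) :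
    ∃ f : M → N, CheapOwned b w f ∧
      (∀ i j n, Reach b w f i n j → easy b w f i ≤ easy b w f j + 1) ∧
      ∀ c, w (f c) c = a → ∀ s, load w f (f c) ≤ load w f s + a := by
  classical
  have hne : Nonempty {f : M → N // CheapOwned b w f} := by
    refine ⟨fun c => if h : ∃ j, w j c = b then h.choose else Classical.arbitrary N, ?_⟩
    intro c hc
    beta_reduce
    rw [dif_pos hc]
    exact hc.choose_spec
  obtain ⟨f₁, hf₁⟩ := Finite.exists_min
    fun f : {f : M → N // CheapOwned b w f} => ∑ t, easy b w f.1 t ^ 2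
  have hne' : Nonempty {f : M → N // CheapOwned b w f ∧
      ∑ t, easy b w f t ^ 2 = ∑ t, easy b w f₁.1 t ^ 2} := ⟨f₁.1, f₁.2, rfl⟩
  obtain ⟨⟨f, hf, hfe⟩, hmin⟩ := Finite.exists_min
    fun f : {f : M → N // CheapOwned b w f ∧
      ∑ t, easy b w f t ^ 2 = ∑ t, easy b w f₁.1 t ^ 2} => ∑ t, load w f.1 t ^ 2
  refine ⟨f, hf, fun i j n hr => ?_, fun c hc s => ?_⟩
  · by_contra! hlt
    have hij : i ≠ j := by
      rintro rfl
      omega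
    obtain ⟨f', hf', he⟩ := hr.exists_transfer n hf
    have h1 := sum_sq_transfer hij he
    have h2 := hf₁ ⟨f', hf'⟩
    simp only at h2
    linarith
  · by_cases hs : f c = s
    · rw [hs]
      omega
    have hnone : ∀ j, w j c ≠ b := fun j hj => by
      have := hf c ⟨j, hj⟩
      omega
    have hall : ∀ j, w j c = a := fun j => (hw j c).resolve_right (hnone j)
    have hf' : CheapOwned b w (Function.update f c s) := by
      intro d hd
      by_cases hdc : d = c
      · subst hdc
        exact absurd hd.choose_spec (hnone _)
      · simpa [hdc] using hf d hd
    have he : easy b w (Function.update f c s) = easy b w f := by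
      funext t
      rw [easy, tally_update]
      simp [hnone]
    have h1 := hmin ⟨Function.update f c s, hf', by rw [he, hfe]⟩
    have h2 := sum_sq_transfer (g := load w f) (g' := load w (Function.update f c s)) (d := a)
      hs fun t => by rw [load, tally_update, hall]
    simp only at h1
    rw [h2] at h1
    have h3 : 0 ≤ 2 * a * (load w f s - load w f (f c) + a) := by linarith
    have h4 := nonneg_of_mul_nonneg_right h3 (by omega)
    linarith

end Balance

section Raise

variable [DecidableEq N] [Fintype M]

/-- `R` is the set of agents whose chores have a raised price. These agents own only chores that
are cheap for them and for nobody outside `R`; the other agents own chores that are cheap for them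
and chores that are cheap for nobody outside `R`. -/
structure RaisedEq (a b : ℤ) (w : N → M → ℤ) (R : Finset N) (f : M → N) : Prop where
  own_cheap : ∀ c, f c ∈ R → w (f c) c = b
  expensive_of_mem : ∀ c, f c ∈ R → ∀ j ∉ R, w j c = a
  expensive_of_notMem : ∀ c, f c ∉ R → w (f c) c = a → ∀ j ∉ R, w j c = a
  load_le_of_expensive : ∀ c, f c ∉ R → w (f c) c = a →
    ∀ s ∉ R, load w f (f c) ≤ load w f s + a
  count_le : ∀ i ∈ R, ∀ j ∈ R, count f i ≤ count f j + 1
  load_le_count : ∀ i ∈ R, ∀ j ∉ R, load w f j ≤ a * count f i + a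
  exists_closed : ∀ t : ℤ, ∃ C : Finset N, (∀ i ∉ R, t ≤ easy b w f i → i ∈ C) ∧
    (∀ i ∈ C, i ∉ R ∧ t ≤ easy b w f i + 1) ∧
    ∀ c, f c ∈ C → w (f c) c = b → ∀ j ∉ R, w j c = b → j ∈ C

/-- A raised equilibrium with at least one raised and one unraised agent, in which unraised agents
with a large load own no more chores than some raised agent. -/
structure ProperRaisedEq (a b : ℤ) (w : N → M → ℤ) (R : Finset N) (f : M → N) : Prop
    extends RaisedEq a b w R f where
  nonempty : R.Nonempty
  exists_notMem : ∃ s, s ∉ R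
  exists_expensive : ∃ c, ∀ j ∉ R, w j c = a
  load_le_or : ∀ j ∉ R, (∀ s ∉ R, load w f j ≤ load w f s + a) ∨
    ∃ i ∈ R, load w f j ≤ b * count f i

variable {a b : ℤ} {w : N → M → ℤ} (hab : b < a) (hb : 0 < b)
  (hw : ∀ i c, w i c = a ∨ w i c = b)

include hab hb hw

/-- The agents reachable from an unraised agent with maximal load can be raised. -/
lemma RaisedEq.raise {R : Finset N} {f : M → N} (h : RaisedEq a b w R f) {j s : N}
    (hj : j ∉ R) (hs : s ∉ R) (hjs : load w f s + b < load w f j)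
    (hexp : ∀ c, f c ∉ R → w (f c) c = a → load w f (f c) < load w f j)
    (hmax : ∀ i ∉ R, load w f i ≤ load w f j)
    (hR : ∀ i ∈ R, b * count f i ≤ load w f j ∧ load w f j ≤ b * count f i + b) :
    ∃ R', R ⊂ R' ∧ ProperRaisedEq a b w R' f := by
  have hjb : ∀ c, f c = j → w j c = b := by
    rintro c rfl
    exact (hw _ c).resolve_left fun hc => lt_irrefl _ (hexp c hj hc)
  have hjl := load_eq_of_forall_easy hjb
  have hje := easy_eq_of_forall_easy hjb
  have hs0 : 0 ≤ load w f s := tally_nonneg fun c => by rcases hw s c with h | h <;> omega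
  obtain ⟨C, hC1, hC2, hC3⟩ := h.exists_closed (count f j)
  have hCb : ∀ c, f c ∈ C → w (f c) c = b := by
    intro c hc
    refine (hw _ c).resolve_left fun hca => ?_
    have h1 := hexp c (hC2 _ hc).1 hca
    have h2 := easy_add_le_load hab hb hw hca
    have h3 := mul_le_mul_of_nonneg_left (hC2 _ hc).2 hb.le
    linarith
  have hCcount : ∀ i ∈ C, count f i ≤ count f j ∧ count f j ≤ count f i + 1 := by
    intro i hi
    have hib : ∀ c, f c = i → w i c = b := by
      rintro c rfl
      exact hCb c hi
    refine ⟨?_, ?_⟩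
    · have := hmax i (hC2 i hi).1
      rw [load_eq_of_forall_easy hib, hjl] at this
      exact le_of_mul_le_mul_left this hb
    · rw [← easy_eq_of_forall_easy hib]
      exact (hC2 i hi).2
  have hRcount : ∀ i ∈ R ∪ C, count f i ≤ count f j ∧ count f j ≤ count f i + 1 := by
    intro i hi
    rcases Finset.mem_union.1 hi with hi | hi
    · have := hR i hi
      rw [hjl] at this
      exact ⟨le_of_mul_le_mul_left this.1 hb,
        le_of_mul_le_mul_left (by linarith [this.2] : b * _ ≤ b * _) hb⟩
    · exact hCcount i hi
  have hjC : j ∈ C := hC1 j hj hje.ge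
  have hsC : s ∉ C := by
    intro hsC
    have h1 := easy_le_load hab hb hw f s
    have h2 := mul_le_mul_of_nonneg_left (hC2 s hsC).2 hb.le
    linarith
  have hsub : ∀ {i}, i ∉ R ∪ C → i ∉ R ∧ i ∉ C := fun hi => by simpa using hi
  have hclosed : ∀ c, f c ∈ C → ∀ i ∉ R ∪ C, w i c = a := fun c hc i hi =>
    (hw i c).resolve_right fun hib => (hsub hi).2 (hC3 c hc (hCb c hc) i (hsub hi).1 hib)
  have hpos : 0 < count f j := by
    have : 0 < b * count f j := by linarith
    exact pos_of_mul_pos_right this hb.le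
  refine ⟨R ∪ C, ?_, ?_⟩
  · exact Finset.ssubset_iff_subset_ne.2 ⟨Finset.subset_union_left, fun he =>
      hj (he ▸ Finset.mem_union_right R hjC)⟩
  refine ⟨⟨?_, ?_, ?_, ?_, ?_, ?_, ?_⟩, ?_, ?_, ?_, ?_⟩
  · intro c hc
    rcases Finset.mem_union.1 hc with hc | hc
    · exact h.own_cheap c hc
    · exact hCb c hc
  · intro c hc i hi
    rcases Finset.mem_union.1 hc with hc | hc
    · exact h.expensive_of_mem c hc i (hsub hi).1
    · exact hclosed c hc i hi
  · exact fun c hc hca i hi => h.expensive_of_notMem c (hsub hc).1 hca i (hsub hi).1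
  · exact fun c hc hca i hi => h.load_le_of_expensive c (hsub hc).1 hca i (hsub hi).1
  · intro i hi i' hi'
    linarith [(hRcount i hi).1, (hRcount i' hi').2]
  · intro i hi i' hi'
    have h1 := hmax i' (hsub hi').1
    have h2 := mul_le_mul_of_nonneg_left (hRcount i hi).2 (hb.trans hab).le
    have h3 := mul_le_mul_of_nonneg_right hab.le hpos.le
    linarith
  · intro t
    obtain ⟨D, hD1, hD2, hD3⟩ := h.exists_closed t
    refine ⟨D \ (R ∪ C), fun i hi hit => ?_, fun i hi => ?_, fun c hc hcb i hi hib => ?_⟩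
    · exact Finset.mem_sdiff.2 ⟨hD1 i (hsub hi).1 hit, hi⟩
    · exact ⟨(Finset.mem_sdiff.1 hi).2, (hD2 i (Finset.mem_sdiff.1 hi).1).2⟩
    · exact Finset.mem_sdiff.2
        ⟨hD3 c (Finset.mem_sdiff.1 hc).1 hcb i (hsub hi).1 hib, hi⟩
  · exact ⟨j, Finset.mem_union_right R hjC⟩
  · exact ⟨s, by simp [hs, hsC]⟩
  · obtain ⟨c, hc⟩ : (bundle f j).Nonempty := by
      rw [Finset.nonempty_iff_ne_empty]
      intro he
      simp [tally, he] at hpos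
    rw [mem_bundle] at hc
    exact ⟨c, hclosed c (hc ▸ hjC)⟩
  · exact fun i hi => Or.inr ⟨j, Finset.mem_union_right R hjC, by
      rw [← hjl]
      exact hmax i (hsub hi).1⟩

/-- A chore of a raised agent can be given to an unraised agent with minimal load. -/
lemma ProperRaisedEq.move [DecidableEq M] {R : Finset N} {f : M → N}
    (h : ProperRaisedEq a b w R f) {r s : N} (hr : r ∈ R) (hs : s ∉ R)
    (hrmax : ∀ i ∈ R, count f i ≤ count f r) (hsmin : ∀ j ∉ R, load w f s ≤ load w f j)
    (hrs : load w f s + a < a * count f r)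
    (hsmall : ∀ j ∉ R, load w f j ≤ load w f s + a ∨ load w f j < b * count f r) :
    ∃ f', ProperRaisedEq a b w R f' ∧ ∑ i ∈ R, count f' i < ∑ i ∈ R, count f i := by
  have ha : 0 < a := hb.trans hab
  have hs0 : 0 ≤ load w f s := tally_nonneg fun c => by rcases hw s c with h | h <;> omega
  have hpos : 0 < count f r := by
    have : 0 < a * count f r := by linarith
    exact pos_of_mul_pos_right this ha.le
  obtain ⟨c₁, hc₁⟩ : (bundle f r).Nonempty := by
    rw [Finset.nonempty_iff_ne_empty]
    intro he
    simp [tally, he] at hpos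
  rw [mem_bundle] at hc₁
  have hexp₁ : ∀ j ∉ R, w j c₁ = a := h.expensive_of_mem c₁ (hc₁ ▸ hr)
  have hsr : s ≠ r := fun e => hs (e ▸ hr)
  have hne : ∀ {i j : N}, i ∈ R → j ∉ R → j ≠ i := fun hi hj e => hj (e ▸ hi)
  set f' := Function.update f c₁ s with hf'
  have hf'c₁ : f' c₁ = s := by simp [hf']
  have hf'd : ∀ d, d ≠ c₁ → f' d = f d := fun d hd => by simp [hf', hd]
  have hload : ∀ j ∉ R, load w f' j = load w f j + if j = s then a else 0 := by
    intro j hj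
    rw [load, hf', tally_update, hc₁, hexp₁ j hj, if_neg (hne hr hj), sub_zero]
  have hloads : load w f' s = load w f s + a := by rw [hload s hs, if_pos rfl]
  have hload_ne : ∀ j ∉ R, j ≠ s → load w f' j = load w f j := fun j hj hjs => by
    rw [hload j hj, if_neg hjs, add_zero]
  have hload_ge : ∀ j ∉ R, load w f s ≤ load w f' j := by
    intro j hj
    rw [hload j hj]
    split_ifs <;> linarith [hsmin j hj]
  have hcount : ∀ i ∈ R, count f' i = count f i - if i = r then 1 else 0 := by
    intro i hi
    rw [count, hf', tally_update, hc₁, if_neg (hne hi hs).symm, add_zero]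
  have hcountr : count f' r = count f r - 1 := by rw [hcount r hr, if_pos rfl]
  have hcount_ge : ∀ i ∈ R, count f r - 1 ≤ count f' i := by
    intro i hi
    rw [hcount i hi]
    split_ifs with hir
    · rw [hir]
    · linarith [h.count_le r hr i hi]
  have heasy : ∀ j ∉ R, easy b w f' j = easy b w f j := by
    intro j hj
    rw [easy, hf', tally_update, hexp₁ j hj]
    simp [hab.ne']
  have hfb : ∀ c, f' c ∉ R → w (f' c) c = b → c ≠ c₁ := by
    rintro c hc hcb rfl
    rw [hexp₁ _ hc] at hcb
    exact hab.ne' hcb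
  have hmem : ∀ c, f' c ∈ R → c ≠ c₁ := by
    rintro c hc rfl
    exact hs (hf'c₁ ▸ hc)
  refine ⟨f', ⟨⟨?_, ?_, ?_, ?_, ?_, ?_, ?_⟩, h.nonempty, h.exists_notMem, h.exists_expensive,
    ?_⟩, ?_⟩
  · intro c hc
    have := hf'd c (hmem c hc)
    rw [this] at hc ⊢
    exact h.own_cheap c hc
  · intro c hc
    rw [hf'd c (hmem c hc)] at hc
    exact h.expensive_of_mem c hc
  · intro c hc hca
    by_cases hcc : c = c₁
    · rw [hcc]
      exact hexp₁
    · rw [hf'd c hcc] at hc hca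
      exact h.expensive_of_notMem c hc hca
  · intro c hc hca t ht
    have h1 := hload_ge t ht
    by_cases hcs : f' c = s
    · rw [hcs, hloads]
      linarith
    · have hcc : c ≠ c₁ := fun e => hcs (e ▸ hf'c₁)
      rw [hload_ne _ hc hcs]
      rw [hf'd c hcc] at hc hca ⊢
      linarith [h.load_le_of_expensive c hc hca s hs]
  · intro i hi j hj
    have h1 := hcount_ge j hj
    have h2 := hrmax i hi
    rw [hcount i hi]
    split_ifs <;> linarith
  · intro i hi j hj
    have h1 := mul_le_mul_of_nonneg_left (hcount_ge i hi) ha.le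
    have h2 := mul_lt_mul_of_pos_right hab hpos
    by_cases hjs : j = s
    · rw [hjs, hloads]
      linarith
    · rw [hload_ne j hj hjs]
      rcases hsmall j hj with h3 | h3 <;> linarith
  · intro t
    obtain ⟨C, hC1, hC2, hC3⟩ := h.exists_closed t
    refine ⟨C, fun i hi => ?_, fun i hi => ?_, fun c hc hcb => ?_⟩
    · rw [heasy i hi]
      exact hC1 i hi
    · rw [heasy i (hC2 i hi).1]
      exact hC2 i hi
    · have hcR : f' c ∉ R := (hC2 _ hc).1
      rw [hf'd c (hfb c hcR hcb)] at hc hcb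
      exact hC3 c hc hcb
  · intro j hj
    by_cases hjs : j = s
    · left
      intro t ht
      rw [hjs, hloads]
      linarith [hload_ge t ht]
    rw [hload_ne j hj hjs]
    by_cases hle : load w f j ≤ load w f s + a
    · exact Or.inl fun t ht => by linarith [hload_ge t ht]
    · right
      refine ⟨r, hr, ?_⟩
      have hjb : ∀ c, f c = j → w j c = b := by
        rintro c rfl
        exact (hw _ c).resolve_left fun hca => hle (h.load_le_of_expensive c hj hca s hs)
      have h1 := (hsmall j hj).resolve_left hle
      rw [load_eq_of_forall_easy hjb] at h1 ⊢
      have h2 := lt_of_mul_lt_mul_left h1 hb.le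
      exact mul_le_mul_of_nonneg_left (by omega) hb.le
  · refine Finset.sum_lt_sum (fun i hi => ?_) ⟨r, hr, by rw [hcountr]; omega⟩
    rw [hcount i hi]
    split_ifs <;> omega

/-- Raising agents and moving chores terminates in an equilibrium in which the prices of any two
bundles differ by at most the raised price of a chore. -/
lemma ProperRaisedEq.exists_fair [Fintype N] [DecidableEq M] {R : Finset N} {f : M → N}
    (h : ProperRaisedEq a b w R f) :
    ∃ R f, ProperRaisedEq a b w R f ∧
      (∀ i ∈ R, ∀ s ∉ R, a * count f i ≤ load w f s + a) ∧
      ∀ j ∉ R, ∀ s ∉ R, load w f j ≤ load w f s + a := by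
  have ha : 0 < a := hb.trans hab
  induction hm : Rᶜ.card using Nat.strong_induction_on generalizing R f with
  | _ m ihm =>
  induction hk : (∑ i ∈ R, count f i).toNat using Nat.strong_induction_on generalizing f with
  | _ k ihk =>
  obtain ⟨r, hr, hrmax⟩ := Finset.exists_max_image R (count f) h.nonempty
  obtain ⟨s, hs, hsmin⟩ := Finset.exists_min_image Rᶜ (load w f)
    (h.exists_notMem.imp fun s hs => Finset.mem_compl.2 hs)
  rw [Finset.mem_compl] at hs
  replace hsmin : ∀ j ∉ R, load w f s ≤ load w f j := fun j hj =>
    hsmin j (Finset.mem_compl.2 hj)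
  by_cases hraise : ∃ j ∉ R, load w f s + a < load w f j ∧ b * count f r ≤ load w f j
  · obtain ⟨j, hj, hjs, hjr⟩ := hraise
    have hbound : ∀ i ∉ R, load w f i ≤ load w f s + a ∨ load w f i ≤ b * count f r :=
      fun i hi => (h.load_le_or i hi).imp (fun H => H s hs) fun ⟨i', hi', H⟩ =>
        H.trans (mul_le_mul_of_nonneg_left (hrmax i' hi') hb.le)
    have hjeq : load w f j = b * count f r := by
      rcases hbound j hj with H | H <;> linarith
    obtain ⟨R', hRR', hR'⟩ := h.toRaisedEq.raise hab hb hw hj hs (by linarith)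
      (fun c hc hca => by linarith [h.load_le_of_expensive c hc hca s hs])
      (fun i hi => by rcases hbound i hi with H | H <;> linarith)
      (fun i hi => by
        have h1 := mul_le_mul_of_nonneg_left (hrmax i hi) hb.le
        have h2 := mul_le_mul_of_nonneg_left (h.count_le r hr i hi) hb.le
        constructor <;> linarith)
    refine ihm _ ?_ hR' rfl
    rw [← hm]
    exact Finset.card_lt_card (Finset.compl_ssubset_compl.2 hRR')
  · push Not at hraise
    have hsmall : ∀ j ∉ R, load w f j ≤ load w f s + a ∨ load w f j < b * count f r :=
      fun j hj => (le_or_gt _ _).imp_right (hraise j hj)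
    by_cases hmove : load w f s + a < a * count f r
    · obtain ⟨f', hf', hlt⟩ := h.move hab hb hw hr hs hrmax hsmin hmove hsmall
      refine ihk _ ?_ hf' rfl
      have h0 : 0 ≤ ∑ i ∈ R, count f' i :=
        Finset.sum_nonneg fun i _ => tally_nonneg fun _ => zero_le_one
      omega
    · have h0 : 0 ≤ count f r := tally_nonneg fun _ => zero_le_one
      have h1 := mul_le_mul_of_nonneg_right hab.le h0
      refine ⟨R, f, h, fun i hi t ht => ?_, fun j hj t ht => ?_⟩
      · have := mul_le_mul_of_nonneg_left (hrmax i hi) ha.le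
        linarith [hsmin t ht]
      · have := hsmin t ht
        rcases hsmall j hj with H | H <;> linarith

end Raise

section Main

variable [DecidableEq N] [Fintype M] {a b : ℤ} {w : N → M → ℤ}

open Classical in
/-- The price of a chore: `a` if it is expensive for all agents outside `R`, and `b` otherwise. -/
noncomputable def raisedPrice (a b : ℤ) (w : N → M → ℤ) (R : Finset N) (c : M) : ℤ :=
  if ∀ j ∉ R, w j c = a then a else b

lemma RaisedEq.tally_price_of_mem {R : Finset N} {f : M → N} (h : RaisedEq a b w R f) {i : N}
    (hi : i ∈ R) : tally (fun _ => raisedPrice a b w R) f i = a * count f i := by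
  rw [tally_congr (g' := fun _ _ => a)]
  · simp [tally, mul_comm]
  · rintro c rfl
    exact if_pos (h.expensive_of_mem c hi)

lemma RaisedEq.price_of_notMem {R : Finset N} {f : M → N} (h : RaisedEq a b w R f) (hab : b < a)
    (hw : ∀ i c, w i c = a ∨ w i c = b) {c : M} (hc : f c ∉ R) :
    raisedPrice a b w R c = w (f c) c := by
  rcases hw (f c) c with H | H
  · rw [H]
    exact if_pos (h.expensive_of_notMem c hc H)
  · rw [H]
    exact if_neg fun H' => by
      have := H' _ hc
      omega

lemma RaisedEq.tally_price_of_notMem {R : Finset N} {f : M → N} (h : RaisedEq a b w R f)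
    (hab : b < a) (hw : ∀ i c, w i c = a ∨ w i c = b) {i : N} (hi : i ∉ R) :
    tally (fun _ => raisedPrice a b w R) f i = load w f i :=
  tally_congr fun c hc => by
    subst hc
    exact h.price_of_notMem hab hw hi

lemma RaisedEq.def_po [Fintype N] [DecidableEq M] [Nonempty N] {v : N → M → ℤ} {R : Finset N}
    {f : M → N}
    (h : RaisedEq a b (fun i c => -v i c) R f) (hab : b < a) (hb : 0 < b)
    (hw : ∀ i c, -v i c = a ∨ -v i c = b) (c₀ : M)
    (hp : ∀ i h, tally (fun _ => raisedPrice a b (fun i c => -v i c) R) f i ≤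
      tally (fun _ => raisedPrice a b (fun i c => -v i c) R) f h +
        raisedPrice a b (fun i c => -v i c) R c₀) :
    ∃ A : N → Finset M, IsAllocation A ∧ DEF v A (Fintype.card N - 1) ∧ ParetoOptimal v A := by
  set p := raisedPrice a b (fun i c => -v i c) R with hpdef
  have hu : ∀ i : N, 0 < if i ∈ R then a else b := fun i => by split_ifs <;> omega
  have hown : ∀ c, (if f c ∈ R then a else b) * -v (f c) c = b * p c := by
    intro c
    split_ifs with hc
    · have h1 : p c = a := if_pos (h.expensive_of_mem c hc)
      have h2 : -v (f c) c = b := h.own_cheap c hc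
      rw [h1, h2, mul_comm]
    · rw [hpdef, h.price_of_notMem hab hw hc]
  have hle : ∀ j c, b * p c ≤ (if j ∈ R then a else b) * -v j c := by
    intro j c
    have hpa : p c ≤ a := by
      rw [hpdef, raisedPrice]
      split_ifs <;> omega
    split_ifs with hj
    · have h1 : b ≤ -v j c := by rcases hw j c with H | H <;> omega
      calc b * p c ≤ b * a := mul_le_mul_of_nonneg_left hpa hb.le
        _ = a * b := mul_comm _ _
        _ ≤ _ := mul_le_mul_of_nonneg_left h1 (hb.trans hab).le
    · refine mul_le_mul_of_nonneg_left ?_ hb.le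
      rw [hpdef, raisedPrice]
      split_ifs with H
      · exact (H j hj).ge
      · rcases hw j c with H | H <;> omega
  refine ⟨bundle f, isAllocation_bundle f, def_of_prices hu hown hle c₀ fun i h => ?_,
    paretoOptimal_of_prices hu hown hle⟩
  have := mul_le_mul_of_nonneg_left (hp i h) hb.le
  simpa only [tally, ← Finset.mul_sum, mul_add] using this

lemma ProperRaisedEq.def_po [Fintype N] [DecidableEq M] [Nonempty N] {v : N → M → ℤ}
    {R : Finset N} {f : M → N}
    (h : ProperRaisedEq a b (fun i c => -v i c) R f) (hab : b < a) (hb : 0 < b)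
    (hw : ∀ i c, -v i c = a ∨ -v i c = b) :
    ∃ A : N → Finset M, IsAllocation A ∧ DEF v A (Fintype.card N - 1) ∧ ParetoOptimal v A := by
  obtain ⟨R, f, h, h1, h2⟩ := h.exists_fair hab hb hw
  obtain ⟨c₀, hc₀⟩ := h.exists_expensive
  refine h.toRaisedEq.def_po hab hb hw c₀ fun i j => ?_
  have hpc : raisedPrice a b (fun i c => -v i c) R c₀ = a := if_pos hc₀
  rw [hpc]
  by_cases hi : i ∈ R <;> by_cases hj : j ∈ R
  · rw [h.tally_price_of_mem hi, h.tally_price_of_mem hj]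
    have := mul_le_mul_of_nonneg_left (h.count_le i hi j hj) (hb.trans hab).le
    linarith
  · rw [h.tally_price_of_mem hi, h.tally_price_of_notMem hab hw hj]
    exact h1 i hi j hj
  · rw [h.tally_price_of_notMem hab hw hi, h.tally_price_of_mem hj]
    exact h.load_le_count j hj i hi
  · rw [h.tally_price_of_notMem hab hw hi, h.tally_price_of_notMem hab hw hj]
    exact h2 i hi j hj

lemma exists_raisedEq_empty [Fintype N] [DecidableEq M] [Nonempty N] (hab : b < a) (hb : 0 < b)
    (hw : ∀ i c, w i c = a ∨ w i c = b) : ∃ f : M → N, RaisedEq a b w ∅ f := by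
  classical
  obtain ⟨f, hf, hreach, hload⟩ := exists_balanced hab hb hw
  refine ⟨f, by simp, by simp, fun c _ hca j _ => ?_, fun c _ hca s _ => hload c hca s, by simp,
    by simp, fun t => ?_⟩
  · refine (hw j c).resolve_right fun hjb => ?_
    have := hf c ⟨j, hjb⟩
    omega
  · refine ⟨univ.filter fun j => ∃ i n, t ≤ easy b w f i ∧ Reach b w f i n j,
      fun i _ hi => ?_, fun j hj => ?_, fun c hc hcb j _ hjb => ?_⟩
    · exact Finset.mem_filter.2 ⟨Finset.mem_univ i, i, 0, hi, rfl⟩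
    · obtain ⟨i, n, hi, hr⟩ := (Finset.mem_filter.1 hj).2
      exact ⟨Finset.notMem_empty j, hi.trans (hreach i j n hr)⟩
    · obtain ⟨i, n, hi, hr⟩ := (Finset.mem_filter.1 hc).2
      exact Finset.mem_filter.2
        ⟨Finset.mem_univ j, i, n + 1, hi, f c, hr, c, rfl, hcb, hjb⟩

lemma exists_def_po [Fintype N] [DecidableEq M] [Nonempty N] {v : N → M → ℤ} (hab : b < a)
    (hb : 0 < b)
    (hw : ∀ i c, -v i c = a ∨ -v i c = b) :
    ∃ A : N → Finset M, IsAllocation A ∧ DEF v A (Fintype.card N - 1) ∧ ParetoOptimal v A := by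
  rcases isEmpty_or_nonempty M with hM | ⟨⟨d⟩⟩
  · have hB : ∀ B : N → Finset M, ∀ i, val (v i) (B i) = 0 := fun B i => by
      simp [_root_.val, Finset.eq_empty_of_isEmpty]
    refine ⟨fun _ => ∅, ⟨by simp, fun c => hM.elim c⟩, ⟨fun _ => 0, by simp, by simp⟩, ?_⟩
    rintro ⟨B, -, -, j, hj⟩
    rw [hB] at hj
    simp [_root_.val] at hj
  obtain ⟨f, h⟩ := exists_raisedEq_empty (N := N) (M := M) hab hb hw
  obtain ⟨j, hj⟩ := Finite.exists_max (load (fun i c => -v i c) f)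
  obtain ⟨s, hs⟩ := Finite.exists_min (load (fun i c => -v i c) f)
  have hfair : ∀ c₀, load (fun i c => -v i c) f j ≤ load (fun i c => -v i c) f s +
      raisedPrice a b (fun i c => -v i c) ∅ c₀ →
      ∃ A : N → Finset M, IsAllocation A ∧ DEF v A (Fintype.card N - 1) ∧
        ParetoOptimal v A := by
    refine fun c₀ H => h.def_po hab hb hw c₀ fun i t => ?_
    rw [h.tally_price_of_notMem hab hw (Finset.notMem_empty i),
      h.tally_price_of_notMem hab hw (Finset.notMem_empty t)]
    linarith [hj i, hs t]
  have hraise : load (fun i c => -v i c) f s + b < load (fun i c => -v i c) f j →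
      (∀ c, -v (f c) c = a → load (fun i c => -v i c) f (f c) <
        load (fun i c => -v i c) f j) →
      ∃ A : N → Finset M, IsAllocation A ∧ DEF v A (Fintype.card N - 1) ∧
        ParetoOptimal v A := by
    intro h1 h2
    obtain ⟨R, -, hR⟩ := h.raise hab hb hw (Finset.notMem_empty j) (Finset.notMem_empty s) h1
      (fun c _ => h2 c) (fun i _ => hj i) (by simp)
    exact hR.def_po hab hb hw
  by_cases huniv : ∃ c, ∀ i, -v i c = a
  · obtain ⟨c, hc⟩ := huniv
    have hpc : raisedPrice a b (fun i c => -v i c) ∅ c = a := if_pos fun i _ => hc i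
    by_cases H : load (fun i c => -v i c) f j ≤ load (fun i c => -v i c) f s + a
    · exact hfair c (by rwa [hpc])
    · refine hraise (by linarith) fun c _ => ?_
      linarith [h.load_le_of_expensive c (Finset.notMem_empty _) ‹_› s (Finset.notMem_empty s)]
  · by_cases H : load (fun i c => -v i c) f j ≤ load (fun i c => -v i c) f s + b
    · refine hfair d (H.trans ?_)
      rw [raisedPrice]
      split_ifs <;> linarith
    · refine hraise (by linarith) fun c hca => ?_
      exact absurd ⟨c, fun i => h.expensive_of_notMem c (Finset.notMem_empty _) hca i
        (Finset.notMem_empty i)⟩ huniv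

end Main

/-- for every chores instance with bivalued valuations (values in {x,y}
for some integers x < y < 0) there exists a DEF-(n-1) and Pareto optimal allocation. -/
theorem bivalued_valuations_exists_def_po {n : ℕ} (hn : 0 < n)
    {M : Type*} [Fintype M] [DecidableEq M]
    (x y : ℤ) (hxy : x < y) (hy : y < 0)
    (v : Fin n → M → ℤ) (hv : ∀ i c, v i c = x ∨ v i c = y) :
    ∃ A : Fin n → Finset M, IsAllocation A ∧ DEF v A (n - 1) ∧ ParetoOptimal v A := by
  have : Nonempty (Fin n) := ⟨⟨0, hn⟩⟩
  simpa using exists_def_po (a := -x) (b := -y) (v := v) (by omega) (by omega)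
    fun i c => (hv i c).imp (congrArg _) (congrArg _)
end

section
/- For every chores instance with n agents, strictly negative valuations, and two types of chores — i.e. M can be partitioned into two sets X and Y such that for every agent i all chores in X have the same value v^X_i < 0 and all chores in Y have the same value v^Y_i < 0 — there exists an allocation that is both DEF-(n-1) and Pareto optimal. -/
open Finset

variable {N M : Type*}

/-- `x i` chores of the first type and `y i` of the second type go to agent `i`, where only agents
in `P` may take the first type and only agents in `Q` the second. -/
structure FeasibleCounts {ι : Type*} [Fintype ι] (P Q : ι → Prop) (s t : ℤ)
    (x y : ι → ℤ) : Prop where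
  nonneg_left : ∀ i, 0 ≤ x i
  nonneg_right : ∀ i, 0 ≤ y i
  sum_left : ∑ i, x i = s
  sum_right : ∑ i, y i = t
  mem_left : ∀ i, 0 < x i → P i
  mem_right : ∀ i, 0 < y i → Q i

/-- Feasible counts minimizing the sum of squared loads at prices `a`, `b`. -/
def BalancedCounts {ι : Type*} [Fintype ι] (P Q : ι → Prop) (s t a b : ℤ)
    (x y : ι → ℤ) : Prop :=
  FeasibleCounts P Q s t x y ∧ ∀ x' y', FeasibleCounts P Q s t x' y' →
    ∑ i, (a * x i + b * y i) ^ 2 ≤ ∑ i, (a * x' i + b * y' i) ^ 2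

section Counts

variable {ι : Type*} [Fintype ι] {P Q : ι → Prop} {s t a b : ℤ} {x y : ι → ℤ}

theorem FeasibleCounts.swap (h : FeasibleCounts P Q s t x y) : FeasibleCounts Q P t s y x :=
  ⟨h.2, h.1, h.4, h.3, h.6, h.5⟩

theorem BalancedCounts.swap (h : BalancedCounts P Q s t a b x y) :
    BalancedCounts Q P t s b a y x := by
  refine ⟨h.1.swap, fun x' y' h' => ?_⟩
  simpa only [add_comm] using h.2 y' x' h'.swap

theorem exists_balancedCounts {k : ι} (hP : P k) (hQ : Q k) (hs : 0 ≤ s) (ht : 0 ≤ t) (a b : ℤ) :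
    ∃ x y, BalancedCounts P Q s t a b x y := by
  classical
  let F := {z : (ι → ℤ) × (ι → ℤ) // FeasibleCounts P Q s t z.1 z.2}
  have h0 : FeasibleCounts P Q s t (fun i => if i = k then s else 0)
      (fun i => if i = k then t else 0) := by
    constructor
    · intro i; split_ifs <;> omega
    · intro i; split_ifs <;> omega
    · simp
    · simp
    · intro i; split_ifs with h
      · exact fun _ => h ▸ hP
      · omega
    · intro i; split_ifs with h
      · exact fun _ => h ▸ hQ
      · omega
  have : Nonempty F := ⟨⟨(_, _), h0⟩⟩
  let φ : F → ℕ := fun z => (∑ i, (a * z.1.1 i + b * z.1.2 i) ^ 2).toNat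
  refine ⟨(Function.argmin φ).1.1, (Function.argmin φ).1.2, (Function.argmin φ).2, ?_⟩
  intro x' y' h'
  have h1 : φ (Function.argmin φ) ≤ φ ⟨(x', y'), h'⟩ := Function.argmin_le φ _
  have h2 : ∀ z : F, (φ z : ℤ) = ∑ i, (a * z.1.1 i + b * z.1.2 i) ^ 2 := fun z =>
    Int.toNat_of_nonneg (Finset.sum_nonneg fun i _ => sq_nonneg _)
  have h3 := h2 (Function.argmin φ)
  have h4 := h2 ⟨(x', y'), h'⟩
  dsimp only at h3 h4
  rw [← h3, ← h4]
  exact_mod_cast h1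

theorem sum_transfer [DecidableEq ι] (i j : ι) :
    ∑ l, ((if l = j then (1 : ℤ) else 0) - (if l = i then 1 else 0)) = 0 := by
  simp

/-- Moving one unit from an agent who has some to an agent allowed to take it. -/
theorem FeasibleCounts.transfer [DecidableEq ι] (h : FeasibleCounts P Q s t x y) {i j : ι}
    (hi : 0 < x i) (hj : P j) : FeasibleCounts P Q s t
      (fun l => x l + ((if l = j then 1 else 0) - (if l = i then 1 else 0))) y := by
  refine ⟨fun l => ?_, h.2, ?_, h.4, fun l hl => ?_, h.6⟩
  · have := h.1 l
    by_cases h1 : l = i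
    · subst h1; split_ifs <;> omega
    · simp only [h1, if_false]; split_ifs <;> omega
  · rw [Finset.sum_add_distrib, sum_transfer, h.3, add_zero]
  · by_cases h1 : l = j
    · exact h1 ▸ hj
    · apply h.5 l
      simp only [h1, if_false] at hl
      split_ifs at hl <;> omega

/-- At a minimizer, one unit of the first type cannot be moved to decrease the gap. -/
theorem BalancedCounts.le_add (h : BalancedCounts P Q s t a b x y) (ha : 0 < a) {i j : ι}
    (hi : 0 < x i) (hj : P j) : a * x i + b * y i ≤ a * x j + b * y j + a := by
  classical
  by_cases hij : i = j
  · subst hij; omega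
  have h1 := h.2 _ _ (h.1.transfer hi hj)
  have h2 : ∑ l, (a * (x l + ((if l = j then 1 else 0) - (if l = i then 1 else 0))) + b * y l) ^ 2
      = ∑ l, ((a * x l + b * y l) ^ 2 + ((if l = j then 2 * a * (a * x l + b * y l) + a ^ 2 else 0)
        + (if l = i then - 2 * a * (a * x l + b * y l) + a ^ 2 else 0))) := by
    refine Finset.sum_congr rfl fun l _ => ?_
    by_cases hl : l = i
    · subst hl; simp only [hij, if_true, if_false]; ring
    · by_cases hl' : l = j
      · subst hl'; simp only [hl, if_true, if_false]; ring
      · simp only [hl, hl', if_false]; ring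
  rw [h2] at h1
  simp only [Finset.sum_add_distrib, Finset.sum_ite_eq', Finset.mem_univ, if_true] at h1
  nlinarith

/-- A middle agent `l` receiving the first type from `i` and passing the second type to `j`
bounds the gap between `i` and `j`. -/
theorem BalancedCounts.le_add_max (h : BalancedCounts P Q s t a b x y) (ha : 0 < a) (hb : 0 < b)
    {i j l : ι} (hi : 0 < x i) (hl : 0 < y l) (hlP : P l) (hj : Q j) :
    a * x i + b * y i ≤ a * x j + b * y j + max a b := by
  classical
  have hma := le_max_left a b
  have hmb := le_max_right a b
  have h1 := h.le_add ha hi hlP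
  have h2 := h.swap.le_add hb hl hj
  by_cases hij : i = j
  · subst hij; omega
  by_cases hil : i = l
  · subst hil; omega
  by_cases hjl : j = l
  · subst hjl; omega
  by_contra! hc
  have h3 := h.2 _ _ ((h.1.transfer hi hlP).swap.transfer hl hj).swap
  have h4 : ∑ m, (a * (x m + ((if m = l then 1 else 0) - (if m = i then 1 else 0)))
        + b * (y m + ((if m = j then 1 else 0) - (if m = l then 1 else 0)))) ^ 2
      = ∑ m, ((a * x m + b * y m) ^ 2
        + ((if m = i then - 2 * a * (a * x m + b * y m) + a ^ 2 else 0)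
        + ((if m = j then 2 * b * (a * x m + b * y m) + b ^ 2 else 0)
        + (if m = l then 2 * (a - b) * (a * x m + b * y m) + (a - b) ^ 2 else 0)))) := by
    refine Finset.sum_congr rfl fun m _ => ?_
    by_cases hm : m = i
    · subst hm; simp only [hij, hil, if_true, if_false]; ring
    by_cases hm' : m = j
    · subst hm'; simp only [hm, hjl, if_true, if_false]; ring
    by_cases hm'' : m = l
    · subst hm''; simp only [hm, hm', if_true, if_false]; ring
    simp only [hm, hm', hm'', if_false]; ring
  rw [h4] at h3
  simp only [Finset.sum_add_distrib, Finset.sum_ite_eq', Finset.mem_univ, if_true] at h3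
  have h5 : 0 ≤ a + (a * x l + b * y l) - (a * x i + b * y i) := by linarith
  have h6 : 0 ≤ b + (a * x j + b * y j) - (a * x l + b * y l) := by linarith
  rcases max_cases a b with h7 | h7
  · nlinarith [mul_pos ha (show 0 < a * x i + b * y i - (a * x j + b * y j) - a by linarith),
      mul_nonneg (sub_nonneg.2 h7.2) h6]
  · nlinarith [mul_pos hb (show 0 < a * x i + b * y i - (a * x j + b * y j) - b by linarith),
      mul_nonneg (sub_nonneg.2 h7.2.le) h5]

/-- The agents of the first type are overloaded, compared with an agent outside `P`. -/
def Overloaded (P : ι → Prop) (a b : ℤ) (x y : ι → ℤ) : Prop :=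
  ∃ i j, 0 < x i ∧ y i = 0 ∧ ¬ P j ∧ a * x i > b * y j + a ∧ ∀ l, P l → y l = 0

theorem BalancedCounts.overloaded (h : BalancedCounts P Q s t a b x y) (ha : 0 < a) (hb : 0 < b)
    (hPQ : ∀ i, P i ∨ Q i) {i j : ι} (hi : 0 < x i)
    (h1 : a * x j + b * y j + a < a * x i + b * y i)
    (h2 : 0 < t → a * x j + b * y j + b < a * x i + b * y i) : Overloaded P a b x y := by
  have hjP : ¬ P j := fun hj => absurd (h.le_add ha hi hj) (by omega)
  have hjQ : Q j := (hPQ j).resolve_left hjP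
  have hxj : x j = 0 := by
    by_contra hne
    exact hjP (h.1.mem_left j (lt_of_le_of_ne (h.1.nonneg_left j) (Ne.symm hne)))
  have ht : ∀ l, 0 < y l → 0 < t := fun l hl => by
    rw [← h.1.sum_right]
    exact Finset.sum_pos' (fun i _ => h.1.nonneg_right i) ⟨l, Finset.mem_univ _, hl⟩
  have hy : ∀ l, P l → y l = 0 := fun l hl => by
    by_contra hne
    have hpos := lt_of_le_of_ne (h.1.nonneg_right l) (Ne.symm hne)
    have h3 := h.le_add_max ha hb hi hpos hl hjQ
    have h4 := h2 (ht l hpos)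
    rcases max_cases a b with h5 | h5 <;> omega
  have hyi := hy i (h.1.mem_left i hi)
  refine ⟨i, j, hi, hyi, hjP, ?_, hy⟩
  rw [hxj, hyi] at h1
  linarith

/-- Either the loads are within the price of an available chore, or one side is overloaded. -/
theorem BalancedCounts.trichotomy (h : BalancedCounts P Q s t a b x y) (ha : 0 < a) (hb : 0 < b)
    (hPQ : ∀ i, P i ∨ Q i) :
    (∀ i j, a * x i + b * y i ≤ a * x j + b * y j ∨
      (0 < s ∧ a * x i + b * y i ≤ a * x j + b * y j + a) ∨
      (0 < t ∧ a * x i + b * y i ≤ a * x j + b * y j + b)) ∨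
    Overloaded P a b x y ∨ Overloaded Q b a y x := by
  by_contra! hc
  obtain ⟨⟨i, j, h0, h1, h2⟩, h3, h4⟩ := hc
  by_cases hi : 0 < x i
  · refine h3 (h.overloaded ha hb hPQ hi (h1 ?_) h2)
    rw [← h.1.sum_left]
    exact Finset.sum_pos' (fun i _ => h.1.nonneg_left i) ⟨i, Finset.mem_univ _, hi⟩
  by_cases hi' : 0 < y i
  · have ht : 0 < t := by
      rw [← h.1.sum_right]
      exact Finset.sum_pos' (fun i _ => h.1.nonneg_right i) ⟨i, Finset.mem_univ _, hi'⟩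
    have h2 := h2 ht
    refine h4 (h.swap.overloaded hb ha (fun i => (hPQ i).symm) (i := i) (j := j) hi' ?_ ?_)
    · linarith
    · intro hs; have := h1 hs; linarith
  · have e1 : x i = 0 := by have := h.1.nonneg_left i; omega
    have e2 : y i = 0 := by have := h.1.nonneg_right i; omega
    have := mul_nonneg ha.le (h.1.nonneg_left j)
    have := mul_nonneg hb.le (h.1.nonneg_right j)
    simp only [e1, e2] at h0
    linarith

/-- Comparison of counts at two consecutive price levels. -/
theorem BalancedCounts.sub_one_le {P' Q' : ι → Prop} {a' b' : ℤ} {x' y' : ι → ℤ}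
    (h : BalancedCounts P Q s t a b x y) (h' : BalancedCounts P' Q' s t a' b' x' y')
    (ha : 0 < a) (ha' : 0 < a') (hb' : 0 < b')
    (hsub : ∀ l, P l → P' l) (hPQ : ∀ l, P l ∨ Q' l)
    (hy : ∀ l, P l → y l = 0) (hx' : ∀ l, Q' l → x' l = 0)
    {i j : ι} (hi : 0 < x i) (hj : P j) (hyj : y' j = 0) : x i - 1 ≤ x' j := by
  by_contra! hc
  have hup : ∀ l, x' l ≤ x' j + 1 := fun l => by
    by_cases hl : 0 < x' l
    · have h1 := h'.le_add ha' hl (hsub j hj)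
      have h2 := mul_nonneg hb'.le (h'.1.nonneg_right l)
      rw [hyj] at h1
      by_contra! h3
      nlinarith
    · have := h'.1.nonneg_left j
      omega
  have hlt : ∑ l, x' l < ∑ l, x l := by
    refine Finset.sum_lt_sum (fun l _ => ?_) ⟨i, Finset.mem_univ _, ?_⟩
    · rcases hPQ l with hl | hl
      · have h1 := h.le_add ha hi hl
        rw [hy i (h.1.mem_left i hi), hy l hl] at h1
        have h2 : x i ≤ x l + 1 := by
          by_contra! h3
          nlinarith
        have := hup l
        omega
      · rw [hx' l hl]
        exact h.1.nonneg_left l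
    · have := hup i
      omega
  rw [h.1.sum_left, h'.1.sum_left] at hlt
  exact lt_irrefl _ hlt

/-- For two types of chores with sizes `s`, `t` and costs `a i`, `b i`, some agent `k` induces
prices `a k`, `b k` at which an equilibrium has loads within the price of an available chore. -/
theorem exists_equilibrium_counts [Nonempty ι] (a b : ι → ℤ) (ha : ∀ i, 0 < a i) (hb : ∀ i, 0 < b i)
    (hs : 0 ≤ s) (ht : 0 ≤ t) :
    ∃ k x y, FeasibleCounts (fun i => a i * b k ≤ a k * b i) (fun i => a k * b i ≤ a i * b k)
        s t x y ∧
      ∀ i j, a k * x i + b k * y i ≤ a k * x j + b k * y j ∨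
        (0 < s ∧ a k * x i + b k * y i ≤ a k * x j + b k * y j + a k) ∨
        (0 < t ∧ a k * x i + b k * y i ≤ a k * x j + b k * y j + b k) := by
  classical
  let r : ι → ℚ := fun i => a i / b i
  have hbq : ∀ i, (0 : ℚ) < b i := fun i => by exact_mod_cast hb i
  have hr : ∀ i k, r i ≤ r k ↔ a i * b k ≤ a k * b i := fun i k => by
    rw [div_le_div_iff₀ (hbq i) (hbq k)]
    exact_mod_cast Iff.rfl
  have hrlt : ∀ i k, r i < r k ↔ a i * b k < a k * b i := fun i k => by
    rw [div_lt_div_iff₀ (hbq i) (hbq k)]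
    exact_mod_cast Iff.rfl
  simp only [← hr]
  have hex : ∀ k, ∃ x y, BalancedCounts (fun i => r i ≤ r k) (fun i => r k ≤ r i) s t
      (a k) (b k) x y :=
    fun k => exists_balancedCounts (P := fun i => r i ≤ r k) (Q := fun i => r k ≤ r i) (k := k)
      le_rfl le_rfl hs ht _ _
  choose x y hxy using hex
  have htri := fun k => (hxy k).trichotomy (ha k) (hb k) (fun i => le_total _ _)
  by_contra! hno
  have hover : ∀ k, Overloaded (fun i => r i ≤ r k) (a k) (b k) (x k) (y k) ∨
      Overloaded (fun i => r k ≤ r i) (b k) (a k) (y k) (x k) := fun k => by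
    rcases htri k with h | h
    · obtain ⟨i, j, h1, h2, h3⟩ := hno k _ _ (hxy k).1
      rcases h i j with h | ⟨h0, h⟩ | ⟨h0, h⟩
      · exact absurd h (not_le.2 h1)
      · exact absurd h (not_le.2 (h2 h0))
      · exact absurd h (not_le.2 (h3 h0))
    · exact h
  let K : Finset ι := {k | ¬ Overloaded (fun i => r i ≤ r k) (a k) (b k) (x k) (y k)}
  have hK : K.Nonempty := by
    obtain ⟨k, -, hk⟩ := Finset.exists_max_image (Finset.univ : Finset ι) r Finset.univ_nonempty
    refine ⟨k, ?_⟩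
    simp only [K, Finset.mem_filter, Finset.mem_univ, true_and]
    rintro ⟨i, j, -, -, hj, -⟩
    exact hj (hk j (Finset.mem_univ _))
  obtain ⟨k', hk'K, hk'⟩ := Finset.exists_min_image K r hK
  have hk'n : ¬ Overloaded (fun i => r i ≤ r k') (a k') (b k') (x k') (y k') := by
    simpa [K] using hk'K
  obtain ⟨i', j', hi', hxi', hj', hgt', hzero'⟩ := (hover k').resolve_left hk'n
  have hj'lt : r j' < r k' := not_le.1 hj'
  obtain ⟨k, hkm, hk⟩ := Finset.exists_max_image ({l | r l < r k'} : Finset ι) r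
    ⟨j', by simpa using hj'lt⟩
  have hkk' : r k < r k' := by simpa using hkm
  have hkle : ∀ l, r l < r k' → r l ≤ r k := fun l hl => hk l (by simpa using hl)
  have hkX : Overloaded (fun i => r i ≤ r k) (a k) (b k) (x k) (y k) := by
    by_contra hn
    exact absurd (hk' k (by simpa [K] using hn)) (not_le.2 hkk')
  obtain ⟨i, j, hi, hyi, hj, hgt, hzero⟩ := hkX
  have hjk' : r k' ≤ r j := by
    by_contra! hlt
    exact hj (hkle j hlt)
  have hxj : x k j = 0 := by
    by_contra hne
    exact hj ((hxy k).1.mem_left j (lt_of_le_of_ne ((hxy k).1.nonneg_left j) (Ne.symm hne)))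
  have hyj' : y k' j' = 0 := by
    by_contra hne
    exact hj' ((hxy k').1.mem_right j'
      (lt_of_le_of_ne ((hxy k').1.nonneg_right j') (Ne.symm hne)))
  have c1 : x k i - 1 ≤ x k' j' :=
    (hxy k).sub_one_le (hxy k') (ha k) (ha k') (hb k') (fun l hl => hl.trans hkk'.le)
      (fun l => (lt_or_ge (r l) (r k')).imp (hkle l) id) hzero hzero' hi (hkle j' hj'lt) hyj'
  have c2 : y k' i' - 1 ≤ y k j :=
    (hxy k').swap.sub_one_le (hxy k).swap (hb k') (hb k) (ha k) (fun l hl => hkk'.le.trans hl)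
      (fun l => (lt_or_ge (r l) (r k')).symm.imp id (hkle l)) hzero' hzero hi' hjk' hxj
  have hab := (hrlt k k').1 hkk'
  have d1 : b k * (y k' i' - 1) < a k * (x k i - 1) := by nlinarith [hb k]
  have d2 : a k' * (x k i - 1) < b k' * (y k' i' - 1) := by nlinarith [ha k']
  have e1 := mul_lt_mul_of_pos_left d1 (ha k')
  have e2 := mul_lt_mul_of_pos_left d2 (ha k)
  have e3 := mul_le_mul_of_nonneg_right hab.le (show 0 ≤ y k' i' - 1 by omega)
  nlinarith

end Counts

/-- An agent's bundle of minimum pain per buck costs less than any bundle of higher price. -/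
theorem cost_lt_of_price_lt {α β a b x y x' y' : ℤ} (hα : 0 < α) (hβ : 0 < β) (ha : 0 < a)
    (hb : 0 < b) (hx : 0 ≤ x) (hy : 0 ≤ y) (hx' : 0 ≤ x') (hy' : 0 ≤ y')
    (hX : 0 < x → α * b ≤ a * β) (hY : 0 < y → a * β ≤ α * b)
    (h : a * x + b * y < a * x' + b * y') : α * x + β * y < α * x' + β * y' := by
  rcases lt_trichotomy (α * b) (a * β) with hc | hc | hc
  · have hy0 : y = 0 := by
      by_contra hne
      exact absurd (hY (lt_of_le_of_ne hy (Ne.symm hne))) (not_le.2 hc)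
    subst hy0
    have h1 := mul_lt_mul_of_pos_left h hα
    have h2 := mul_le_mul_of_nonneg_right hc.le hy'
    refine lt_of_mul_lt_mul_left (a := a) ?_ ha.le
    linarith
  · have h1 := mul_lt_mul_of_pos_left h hα
    refine lt_of_mul_lt_mul_left (a := a) ?_ ha.le
    have h2 : α * (b * y) = a * (β * y) := by rw [← mul_assoc, hc, mul_assoc]
    have h3 : α * (b * y') = a * (β * y') := by rw [← mul_assoc, hc, mul_assoc]
    linarith
  · have hx0 : x = 0 := by
      by_contra hne
      exact absurd (hX (lt_of_le_of_ne hx (Ne.symm hne))) (not_le.2 hc)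
    subst hx0
    have h1 := mul_lt_mul_of_pos_left h hβ
    have h2 := mul_le_mul_of_nonneg_right hc.le hx'
    refine lt_of_mul_lt_mul_left (a := b) ?_ hb.le
    linarith

/-- An agent's bundle of minimum pain per buck costs at most as much as any bundle of at least its
price. -/
theorem cost_le_of_price_le {α β a b x y x' y' : ℤ} (hα : 0 < α) (hβ : 0 < β) (ha : 0 < a)
    (hb : 0 < b) (hx : 0 ≤ x) (hy : 0 ≤ y) (hx' : 0 ≤ x') (hy' : 0 ≤ y')
    (hX : 0 < x → α * b ≤ a * β) (hY : 0 < y → a * β ≤ α * b)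
    (h : a * x + b * y ≤ a * x' + b * y') : α * x + β * y ≤ α * x' + β * y' := by
  rcases le_total (α * b) (a * β) with hc | hc
  · have h0 : α * (b * y) = a * (β * y) := by
      rcases hy.eq_or_lt with h0 | h0
      · simp [← h0]
      · rw [← mul_assoc, le_antisymm hc (hY h0), mul_assoc]
    have h1 := mul_le_mul_of_nonneg_left h hα.le
    have h2 := mul_le_mul_of_nonneg_right hc hy'
    refine le_of_mul_le_mul_left (a := a) ?_ ha
    linarith
  · have h0 : β * (a * x) = b * (α * x) := by
      rcases hx.eq_or_lt with h0 | h0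
      · simp [← h0]
      · linear_combination (x : ℤ) * le_antisymm hc (hX h0)
    have h1 := mul_le_mul_of_nonneg_left h hβ.le
    have h2 := mul_le_mul_of_nonneg_right hc hx'
    refine le_of_mul_le_mul_left (a := b) ?_ hb
    linarith

/-- A finite set can be coloured with prescribed colour class sizes. -/
theorem exists_coloring_card {ι M : Type*} [Fintype ι] [DecidableEq ι] [Nonempty ι]
    [DecidableEq M] (S : Finset M) (x : ι → ℤ) (hx0 : ∀ i, 0 ≤ x i) (hx : ∑ i, x i = S.card) :
    ∃ f : M → ι, ∀ i, ((S.filter fun c => f c = i).card : ℤ) = x i := by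
  lift x to ι → ℕ using hx0
  have hx' : ∑ i, x i = S.card := by
    dsimp only at hx
    exact_mod_cast hx
  let e : S ≃ Σ i, Fin (x i) := Fintype.equivOfCardEq (by simp [hx'])
  let f : M → ι := fun c => if h : c ∈ S then (e ⟨c, h⟩).1 else Classical.arbitrary ι
  have hf : ∀ c : S, f c = (e c).1 := fun c => by simp [f]
  refine ⟨f, fun i => ?_⟩
  have h1 : (S.filter fun c => f c = i).card = Fintype.card {c : S // (e c).1 = i} := by
    rw [Fintype.card_subtype]
    symm
    refine Finset.card_bij (fun c _ => (c : M)) ?_ ?_ ?_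
    · intro c hc
      simp only [Finset.mem_filter, Finset.mem_univ, true_and] at hc
      exact Finset.mem_filter.2 ⟨c.2, (hf c).trans hc⟩
    · intro c _ d _ h
      exact Subtype.ext h
    · intro c hc
      obtain ⟨hcS, hc⟩ := Finset.mem_filter.1 hc
      exact ⟨⟨c, hcS⟩, by simpa using (hf ⟨c, hcS⟩).symm.trans hc, rfl⟩
  have h2 : Fintype.card {c : S // (e c).1 = i} = x i := by
    rw [← Fintype.card_fin (x i)]
    exact Fintype.card_congr ((e.subtypeEquiv (q := fun z => z.1 = i) fun c => Iff.rfl).trans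
      (Equiv.sigmaSubtype i))
  rw [h1, h2]

theorem val_eq_of_two_types {M : Type*} [Fintype M] [DecidableEq M] {X Y : Finset M}
    (hXY : Disjoint X Y) (hXYuniv : X ∪ Y = Finset.univ) {v : M → ℤ} {vX vY : ℤ}
    (hv : ∀ c, v c = if c ∈ X then vX else vY) (S : Finset M) :
    val v S = vX * (X ∩ S).card + vY * (Y ∩ S).card := by
  have hS : S = (X ∩ S) ∪ (Y ∩ S) := by
    rw [← Finset.union_inter_distrib_right, hXYuniv, Finset.univ_inter]
  have hd : Disjoint (X ∩ S) (Y ∩ S) := hXY.mono Finset.inter_subset_left Finset.inter_subset_left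
  have h1 : ∑ c ∈ X ∩ S, v c = ∑ c ∈ X ∩ S, vX :=
    Finset.sum_congr rfl fun c hc => by rw [hv, if_pos (Finset.mem_inter.1 hc).1]
  have h2 : ∑ c ∈ Y ∩ S, v c = ∑ c ∈ Y ∩ S, vY := Finset.sum_congr rfl fun c hc => by
    rw [hv, if_neg (Finset.disjoint_right.1 hXY (Finset.mem_inter.1 hc).1)]
  unfold _root_.val
  conv_lhs => rw [hS]
  rw [Finset.sum_union hd, h1, h2]
  simp [mul_comm]

theorem IsAllocation.sum_card_inter {N M : Type*} [Fintype N] [DecidableEq M]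
    {A : N → Finset M} (hA : IsAllocation A) (S : Finset M) :
    ∑ i, ((S ∩ A i).card : ℤ) = S.card := by
  classical
  have h : S = Finset.univ.biUnion fun i => S ∩ A i := by
    ext c
    simpa using fun _ => hA.2 c
  conv_rhs => rw [h]
  rw [Finset.card_biUnion]
  · push_cast
    rfl
  · intro i _ j _ hij
    exact (hA.1 i j hij).mono Finset.inter_subset_right Finset.inter_subset_right

/-- for every chores instance with strictly negative valuations and two
types of chores, there exists a DEF-(n-1) and Pareto optimal allocation. -/
theorem two_types_exists_def_po {n : ℕ} (hn : 0 < n)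
    {M : Type*} [Fintype M] [DecidableEq M]
    (X Y : Finset M) (hXY : Disjoint X Y) (hXYuniv : X ∪ Y = Finset.univ)
    (vX vY : Fin n → ℤ) (hvX : ∀ i, vX i < 0) (hvY : ∀ i, vY i < 0)
    (v : Fin n → M → ℤ) (hv : ∀ i c, v i c = if c ∈ X then vX i else vY i) :
    ∃ A : Fin n → Finset M, IsAllocation A ∧ DEF v A (n - 1) ∧ ParetoOptimal v A := by
  classical
  have : Nonempty (Fin n) := ⟨⟨0, hn⟩⟩
  have ha : ∀ i, 0 < -vX i := fun i => by have := hvX i; omega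
  have hb : ∀ i, 0 < -vY i := fun i => by have := hvY i; omega
  obtain ⟨k, x, y, hF, hload⟩ := exists_equilibrium_counts (s := X.card) (t := Y.card)
    (fun i => -vX i) (fun i => -vY i) ha hb (Int.natCast_nonneg _) (Int.natCast_nonneg _)
  obtain ⟨f, hf⟩ := exists_coloring_card X x hF.nonneg_left hF.sum_left
  obtain ⟨g, hg⟩ := exists_coloring_card Y y hF.nonneg_right hF.sum_right
  let A : Fin n → Finset M := fun i => Finset.univ.filter fun c => (if c ∈ X then f c else g c) = i
  have hAX : ∀ i, ((X ∩ A i).card : ℤ) = x i := fun i => by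
    rw [← hf i]
    congr 2
    ext c
    simp only [A, Finset.mem_inter, Finset.mem_filter, Finset.mem_univ, true_and]
    exact and_congr_right fun h => by rw [if_pos h]
  have hAY : ∀ i, ((Y ∩ A i).card : ℤ) = y i := fun i => by
    rw [← hg i]
    congr 2
    ext c
    simp only [A, Finset.mem_inter, Finset.mem_filter, Finset.mem_univ, true_and]
    exact and_congr_right fun h => by rw [if_neg (Finset.disjoint_right.1 hXY h)]
  have hA : IsAllocation A := by
    refine ⟨fun i j hij => Finset.disjoint_left.2 fun c hi hj => hij ?_, fun c =>
      ⟨if c ∈ X then f c else g c, ?_⟩⟩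
    · simp only [A, Finset.mem_filter, Finset.mem_univ, true_and] at hi hj
      exact hi.symm.trans hj
    · simp only [A, Finset.mem_filter, Finset.mem_univ, true_and]
  have hval : ∀ i (S : Finset M), val (v i) S = vX i * (X ∩ S).card + vY i * (Y ∩ S).card :=
    fun i S => val_eq_of_two_types hXY hXYuniv (hv i) S
  have hvalA : ∀ i j, val (v i) (A j) = vX i * x j + vY i * y j := fun i j => by
    rw [hval, hAX, hAY]
  have hle : ∀ i {x' y' : ℤ}, 0 ≤ x' → 0 ≤ y' →
      -vX k * x i + -vY k * y i ≤ -vX k * x' + -vY k * y' →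
      -vX i * x i + -vY i * y i ≤ -vX i * x' + -vY i * y' := fun i x' y' hx' hy' h =>
    cost_le_of_price_le (ha i) (hb i) (ha k) (hb k) (hF.nonneg_left i) (hF.nonneg_right i) hx' hy'
      (hF.mem_left i) (hF.mem_right i) h
  have hlt : ∀ i {x' y' : ℤ}, 0 ≤ x' → 0 ≤ y' →
      -vX k * x i + -vY k * y i < -vX k * x' + -vY k * y' →
      -vX i * x i + -vY i * y i < -vX i * x' + -vY i * y' := fun i x' y' hx' hy' h =>
    cost_lt_of_price_lt (ha i) (hb i) (ha k) (hb k) (hF.nonneg_left i) (hF.nonneg_right i) hx' hy'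
      (hF.mem_left i) (hF.mem_right i) h
  refine ⟨A, hA, ?_, ?_⟩
  · obtain ⟨m, -, hm⟩ := Finset.exists_max_image (Finset.univ : Finset (Fin n))
      (fun i => -vX k * x i + -vY k * y i) Finset.univ_nonempty
    have hm' : ∀ i, -vX k * x i + -vY k * y i ≤ -vX k * x m + -vY k * y m :=
      fun i => hm i (Finset.mem_univ i)
    rcases isEmpty_or_nonempty M with hM | hM
    · refine ⟨fun _ => 0, by simp, fun i h _ => ?_⟩
      simp [_root_.val, Finset.eq_empty_of_isEmpty]
    obtain ⟨c, -, hc⟩ := Finset.exists_max_image (Finset.univ : Finset M)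
      (fun c => -v k c) Finset.univ_nonempty
    have hc' : ∀ d, -v k d ≤ -v k c := fun d => hc d (Finset.mem_univ d)
    have hcpos : 0 ≤ -v k c := by
      rw [hv]
      split_ifs
      · exact (ha k).le
      · exact (hb k).le
    have hspread : ∀ i j, -vX k * x i + -vY k * y i ≤ -vX k * x j + -vY k * y j + -v k c := by
      intro i j
      rcases hload i j with h | ⟨h0, h⟩ | ⟨h0, h⟩
      · linarith
      · obtain ⟨d, hd⟩ := Finset.card_pos.1 (by exact_mod_cast h0 : 0 < X.card)
        have := hc' d
        rw [hv k d, if_pos hd] at this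
        linarith
      · obtain ⟨d, hd⟩ := Finset.card_pos.1 (by exact_mod_cast h0 : 0 < Y.card)
        have := hc' d
        rw [hv k d, if_neg (Finset.disjoint_right.1 hXY hd)] at this
        linarith
    refine ⟨fun h => if h = m then 0 else {c}, ?_, fun i h _ => ?_⟩
    · have : ∀ i, Multiset.card (if i = m then (0 : Multiset M) else {c})
          = if i = m then 0 else 1 := fun i => by split_ifs <;> rfl
      simp only [this]
      rw [Finset.sum_ite]
      simp [Finset.filter_ne', Finset.card_erase_of_mem]
    · rw [hvalA, hvalA]
      by_cases hh : h = m
      · subst hh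
        have := hle i (hF.nonneg_left h) (hF.nonneg_right h) (hm' i)
        simp only [if_true, Multiset.map_zero, Multiset.sum_zero]
        linarith
      · simp only [if_neg hh, Multiset.map_singleton, Multiset.sum_singleton]
        have h1 := hspread i h
        have h2 := hF.nonneg_left h
        have h3 := hF.nonneg_right h
        rw [hv] at h1 ⊢
        split_ifs at h1 ⊢
        · have := hle i (x' := x h + 1) (y' := y h) (by omega) h3 (by linarith)
          linarith
        · have := hle i (x' := x h) (y' := y h + 1) h2 (by omega) (by linarith)
          linarith
  · rintro ⟨B, hB, hBle, j, hBj⟩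
    have h1 : ∀ i, -vX k * (X ∩ B i).card + -vY k * (Y ∩ B i).card
        ≤ -vX k * x i + -vY k * y i := fun i => by
      by_contra! hc
      have := hlt i (Int.natCast_nonneg _) (Int.natCast_nonneg _) hc
      have h2 := hBle i
      rw [hvalA, hval] at h2
      linarith
    have h2 : -vX k * (X ∩ B j).card + -vY k * (Y ∩ B j).card < -vX k * x j + -vY k * y j := by
      by_contra! hc
      have := hle j (Int.natCast_nonneg _) (Int.natCast_nonneg _) hc
      rw [hvalA, hval] at hBj
      linarith
    have h3 := Finset.sum_lt_sum (fun i _ => h1 i) ⟨j, Finset.mem_univ j, h2⟩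
    simp only [Finset.sum_add_distrib, ← Finset.mul_sum, hB.sum_card_inter, hF.sum_left,
      hF.sum_right] at h3
    exact lt_irrefl _ h3
end

section
/- Consider a chores instance with n agents, strictly negative valuations, and two types of chores: M = X ∪ Y with X, Y disjoint, where for each agent i all chores in X have the same value v^X_i < 0 and all chores in Y have the same value v^Y_i < 0. Suppose an allocation A and an agent i* satisfy: (1) every agent other than i* receives chores of only one type; (2) every agent i with v^X_i / v^X_{i*} < v^Y_i / v^Y_{i*} receives only chores of type X; (3) every agent i with v^X_i / v^X_{i*} > v^Y_i / v^Y_{i*} receives only chores of type Y; and (4) A is envy-free up to one chore (EF1) in the modified instance in which every agent's valuation is replaced by v_{i*}. Then A is DEF-(n-1). -/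
open Finset

variable {N M : Type*}

/-- Any multiple of the comparison valuation that dominates `u` chorewise dominates it on bundles. -/
theorem val_le_mul_val {u w : M → ℤ} {r : ℚ} (h : ∀ c, (u c : ℚ) ≤ r * w c) (S : Finset M) :
    (val u S : ℚ) ≤ r * val w S := by
  simp only [_root_.val, Int.cast_sum, Finset.mul_sum]
  exact Finset.sum_le_sum fun c _ => h c

theorem val_eq_mul_val {u w : M → ℤ} {r : ℚ} {S : Finset M}
    (h : ∀ c ∈ S, (u c : ℚ) = r * w c) : (val u S : ℚ) = r * val w S := by
  simp only [_root_.val, Int.cast_sum, Finset.mul_sum]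
  exact Finset.sum_congr rfl h

/-- If an allocation is EF1 for a nonpositive valuation `w`, and every agent's valuation is dominated
by a nonnegative multiple of `w` with equality on the agent's own bundle, then the allocation is
envy-free up to `n - 1` dubious chores. -/
theorem EF1.def_of_dominated [Fintype N] [DecidableEq N] [Nonempty N] [Fintype M] [DecidableEq M]
    {v : N → M → ℤ} {w : M → ℤ} {A : N → Finset M} (hw : ∀ c, w c ≤ 0)
    (hA : EF1 (fun _ : N => w) A) (r : N → ℚ) (hr : ∀ i, 0 ≤ r i)
    (heq : ∀ i, ∀ c ∈ A i, (v i c : ℚ) = r i * w c)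
    (hle : ∀ i c, (v i c : ℚ) ≤ r i * w c) :
    DEF v A (Fintype.card N - 1) := by
  rcases isEmpty_or_nonempty M with hM | hM
  · refine ⟨fun _ => 0, by simp, fun i h _ => ?_⟩
    simp [_root_.val, Finset.eq_empty_of_isEmpty]
  obtain ⟨g, hg⟩ := Finite.exists_min w
  obtain ⟨m, hm⟩ := Finite.exists_min fun i => val w (A i)
  refine ⟨fun h => if h = m then 0 else {g}, ?_, fun i h hih => ?_⟩
  · have hcard (h : N) : Multiset.card (if h = m then (0 : Multiset M) else {g}) =
        if h ≠ m then 1 else 0 := by split_ifs <;> simp_all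
    simp only [hcard, Finset.sum_boole, Finset.filter_ne', Finset.card_erase_of_mem,
      Finset.mem_univ, Finset.card_univ, Nat.cast_id, le_refl]
  · have hval : (val (v i) (A h) : ℚ) ≤ r i * val w (A h) := val_le_mul_val (hle i) _
    have hown : (val (v i) (A i) : ℚ) = r i * val w (A i) := val_eq_mul_val (heq i)
    beta_reduce
    split_ifs with hhm
    · subst hhm
      have hmul := mul_le_mul_of_nonneg_left (Int.cast_le (R := ℚ).mpr (hm i)) (hr i)
      have : (val (v i) (A h) : ℚ) ≤ val (v i) (A i) := by linarith
      simpa using this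
    · have key : val w (A h) + w g ≤ val w (A i) := by
        by_cases hemp : A i = ∅
        · have hsum : val w (A h) ≤ 0 := Finset.sum_nonpos fun c _ => hw c
          have hzero : val w (A i) = 0 := by simp [_root_.val, hemp]
          linarith [hw g]
        · obtain ⟨c, hc, hce⟩ := hA i h hih hemp
          have hsum : val w ((A i).erase c) + w c = val w (A i) := Finset.sum_erase_add _ _ hc
          linarith [hg c]
      have hmul := mul_le_mul_of_nonneg_left (Int.cast_le (R := ℚ).mpr key) (hr i)
      have : (val (v i) (A h) : ℚ) + v i g ≤ val (v i) (A i) := by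
        push_cast at hmul
        linarith [hle i g]
      simpa using mod_cast this

/-- in a two-type chores instance, an allocation satisfying the four
conditions of Aziz et al.'s algorithm (with distinguished agent `istar`) is DEF-(n-1). -/
theorem two_types_conditions_imply_def {n : ℕ} {M : Type*} [Fintype M] [DecidableEq M]
    (X Y : Finset M) (hXY : Disjoint X Y) (hXYuniv : X ∪ Y = Finset.univ)
    (vX vY : Fin n → ℤ) (hvX : ∀ i, vX i < 0) (hvY : ∀ i, vY i < 0)
    (v : Fin n → M → ℤ) (hv : ∀ i c, v i c = if c ∈ X then vX i else vY i)
    (A : Fin n → Finset M) (hA : IsAllocation A)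
    (istar : Fin n)
    (h1 : ∀ i : Fin n, i ≠ istar → A i ⊆ X ∨ A i ⊆ Y)
    (h2 : ∀ i : Fin n,
      (vX i : ℚ) / (vX istar : ℚ) < (vY i : ℚ) / (vY istar : ℚ) → A i ⊆ X)
    (h3 : ∀ i : Fin n,
      (vX i : ℚ) / (vX istar : ℚ) > (vY i : ℚ) / (vY istar : ℚ) → A i ⊆ Y)
    (h4 : EF1 (fun _ : Fin n => v istar) A) :
    DEF v A (n - 1) := by
  have hX (i : Fin n) : (vX i : ℚ) < 0 := mod_cast hvX i
  have hY (i : Fin n) : (vY i : ℚ) < 0 := mod_cast hvY i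
  have hYX : ∀ c ∈ Y, c ∉ X := fun c hc hcX => Finset.disjoint_left.mp hXY hcX hc
  have hqX (i : Fin n) : (vX i : ℚ) = vX i / vX istar * vX istar :=
    (div_mul_cancel₀ _ (hX istar).ne).symm
  have hqY (i : Fin n) : (vY i : ℚ) = vY i / vY istar * vY istar :=
    (div_mul_cancel₀ _ (hY istar).ne).symm
  have : Nonempty (Fin n) := ⟨istar⟩
  have hw : ∀ c, v istar c ≤ 0 := fun c => by
    rw [hv]
    split_ifs
    exacts [(hvX istar).le, (hvY istar).le]
  have hDEF := h4.def_of_dominated (v := v) hw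
    (fun i => min ((vX i : ℚ) / vX istar) ((vY i : ℚ) / vY istar))
    (fun i => le_min (div_nonneg_of_nonpos (hX i).le (hX istar).le)
      (div_nonneg_of_nonpos (hY i).le (hY istar).le)) ?_ ?_
  · simpa using hDEF
  · intro i c hc
    rw [hv, hv]
    rcases lt_trichotomy ((vX i : ℚ) / vX istar) ((vY i : ℚ) / vY istar) with h | h | h
    · rw [min_eq_left h.le, if_pos (h2 i h hc), if_pos (h2 i h hc)]
      exact hqX i
    · split_ifs
      · rw [min_eq_left h.le]
        exact hqX i
      · rw [min_eq_right h.ge]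
        exact hqY i
    · rw [min_eq_right h.le, if_neg (hYX c (h3 i h hc)), if_neg (hYX c (h3 i h hc))]
      exact hqY i
  · intro i c
    rw [hv, hv]
    split_ifs
    · exact (hqX i).trans_le (mul_le_mul_of_nonpos_right (min_le_left _ _) (hX istar).le)
    · exact (hqY i).trans_le (mul_le_mul_of_nonpos_right (min_le_right _ _) (hY istar).le)
end

section
/- Let k ≥ 1, n = 3k, let U = {u_1,…,u_n} be a universe, and let S_1,…,S_m (with m = n) be 3-element subsets of U such that every element of U belongs to exactly 3 of the sets. Construct the chores instance with agents {0,1,…,n} and chores consisting of dummy chores d^r_{i,j} for each r ∈ {1,2,3,4} and each ordered pair (i,j) ∈ {1,…,n}², together with chores c_1,…,c_m. Valuations: agent 0 values every chore at 0; for each agent i ∈ {1,…,n}, v_i(d^r_{j,l}) = -1 if j = i and 0 otherwise, and v_i(c_j) = -1 if u_i ∈ S_j and 0 otherwise. Let A be the allocation with A_0 = {c_1,…,c_m} and A_i = {d^r_{j,i} : r ∈ {1,2,3,4}, j ∈ {1,…,n}} for each i ∈ {1,…,n}. Then A is DEF-k if and only if there exists a subfamily K ⊆ {S_1,…,S_m}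 with |K| = k and ∪_{S∈K} S = U. (This is the reduction showing that deciding whether a given allocation is DEF-k is NP-complete.) -/
open Finset

variable {N M : Type*}

/-- the RX3C reduction: the given allocation of the constructed instance
is DEF-k if and only if the RX3C instance admits a cover of size k. -/
theorem verify_def_iff_exact_cover (k : ℕ) (hk : 1 ≤ k)
    (S : Fin (3 * k) → Finset (Fin (3 * k)))
    (hS3 : ∀ j, (S j).card = 3)
    (hocc : ∀ i : Fin (3 * k), (Finset.univ.filter fun j => i ∈ S j).card = 3)
    (v : Option (Fin (3 * k)) → ((Fin 4 × Fin (3 * k) × Fin (3 * k)) ⊕ Fin (3 * k)) → ℤ)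
    (hv0 : ∀ c, v none c = 0)
    (hvd : ∀ i : Fin (3 * k), ∀ r : Fin 4, ∀ j l : Fin (3 * k),
      v (some i) (Sum.inl (r, j, l)) = if j = i then -1 else 0)
    (hvc : ∀ i j : Fin (3 * k), v (some i) (Sum.inr j) = if i ∈ S j then -1 else 0)
    (A : Option (Fin (3 * k)) →
      Finset ((Fin 4 × Fin (3 * k) × Fin (3 * k)) ⊕ Fin (3 * k)))
    (hA0 : A none = (Finset.univ : Finset (Fin (3 * k))).image Sum.inr)
    (hAi : ∀ i : Fin (3 * k), A (some i) =
      (Finset.univ : Finset (Fin 4 × Fin (3 * k))).image fun p => Sum.inl (p.1, p.2, i)) :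
    DEF v A k ↔
      ∃ K : Finset (Fin (3 * k)), K.card = k ∧
        ∀ i : Fin (3 * k), ∃ j ∈ K, i ∈ S j := by
  have hA0val (i : Fin (3 * k)) : val (v (some i)) (A none) = -3 := by
    rw [_root_.val, hA0, Finset.sum_image Sum.inr_injective.injOn]
    simp only [hvc]
    rw [← Finset.sum_filter, Finset.sum_const, hocc i]
    norm_num
  have hAval (i l : Fin (3 * k)) : val (v (some i)) (A (some l)) = -4 := by
    rw [_root_.val, hAi, Finset.sum_image (by intro p _ q _ h; simpa [Prod.ext_iff] using h)]
    simp [hvd, Fintype.sum_prod_type]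
  constructor
  · rintro ⟨D, hcard, hD⟩
    have hmem (i : Fin (3 * k)) : ∃ j, i ∈ S j := by
      obtain ⟨j, hj⟩ := Finset.card_pos.mp (by rw [hocc i]; norm_num)
      exact ⟨j, (Finset.mem_filter.mp hj).2⟩
    choose f hf using hmem
    let g : (Fin 4 × Fin (3 * k) × Fin (3 * k)) ⊕ Fin (3 * k) → Fin (3 * k) :=
      Sum.elim (fun d => f d.2.1) id
    have hg (i : Fin (3 * k)) (c) (hc : v (some i) c ≠ 0) : i ∈ S (g c) := by
      rcases c with ⟨r, j, l⟩ | j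
      · obtain rfl : j = i := by simpa [hvd] using hc
        exact hf j
      · simpa [hvc, g] using hc
    have hle : ((D none).map g).toFinset.card ≤ k := by
      calc ((D none).map g).toFinset.card ≤ ((D none).map g).card :=
            Multiset.toFinset_card_le _
        _ = (D none).card := Multiset.card_map _ _
        _ ≤ ∑ i, (D i).card :=
            Finset.single_le_sum (f := fun i => (D i).card) (fun _ _ => Nat.zero_le _)
              (Finset.mem_univ none)
        _ ≤ k := hcard
    obtain ⟨K, hsub, hK⟩ := Finset.exists_superset_card_eq hle
      (by rw [Fintype.card_fin]; omega)
    refine ⟨K, hK, fun i => ?_⟩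
    have henvy := hD (some i) none (by simp)
    rw [hAval, hA0val] at henvy
    obtain ⟨c, hc, hvc0⟩ : ∃ c ∈ D none, v (some i) c ≠ 0 := by
      by_contra! h
      rw [Multiset.map_congr rfl h] at henvy
      simp at henvy
    exact ⟨g c, hsub (Multiset.mem_toFinset.mpr (Multiset.mem_map_of_mem g hc)), hg i c hvc0⟩
  · rintro ⟨K, hK, hcover⟩
    refine ⟨fun a => a.elim (K.val.map Sum.inr) fun _ => 0, by simp [hK], ?_⟩
    rintro (_ | i) (_ | l) hne
    · exact absurd rfl hne
    · simp [_root_.val, hv0]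
    · obtain ⟨j, hj, hij⟩ := hcover i
      have hsum : ∑ j ∈ K, v (some i) (Sum.inr j) ≤ v (some i) (Sum.inr j) := by
        rw [← Finset.add_sum_erase K _ hj]
        have := Finset.sum_nonpos (s := K.erase j) (f := fun j => v (some i) (Sum.inr j))
          (fun x _ => by rw [hvc]; split_ifs <;> norm_num)
        linarith
      rw [hvc i j, if_pos hij] at hsum
      have hmap : (Multiset.map (v (some i)) (K.val.map Sum.inr)).sum
          = ∑ j ∈ K, v (some i) (Sum.inr j) := by
        rw [Multiset.map_map]; rfl
      rw [hAval, hA0val]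
      simp only [Option.elim, hmap]
      linarith
    · simp [hAval]
end

section
/- Let x_1,…,x_n be positive integers with Σ_{i=1}^n x_i = 2T, and let k ≥ 0 be an integer. Construct the chores instance with 2k+2 agents and n+k chores with identical valuations: main chores c_1,…,c_n, where every agent values c_j at -x_j, and dummy chores c_{n+1},…,c_{n+k}, each valued at -T by every agent. Then this instance admits a DEF-k allocation if and only if there exists Y ⊆ {1,…,n} with Σ_{i∈Y} x_i = T. (This is the reduction from PARTITION showing that deciding the existence of a DEF-k allocation is NP-complete for identical valuations.) -/
open Finset

variable {N M : Type*}

/-- The values of the bundles of an allocation add up to the value of all chores. -/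
theorem IsAllocation.sum_val [Fintype N] [Fintype M] [DecidableEq M] {A : N → Finset M}
    (hA : IsAllocation A) (v : M → ℤ) : ∑ i, val v (A i) = ∑ c, v c := by
  have hU : univ.biUnion A = univ := by
    ext c
    simpa using hA.2 c
  rw [← hU, sum_biUnion fun i _ j _ hij => hA.1 i j hij]
  rfl

/-- The fibers of a map from chores to agents form an allocation. -/
theorem isAllocation_fiber [Fintype M] [DecidableEq M] [DecidableEq N] (f : M → N) :
    IsAllocation fun i => univ.filter fun c => f c = i := by
  refine ⟨fun i j hij => ?_, fun c => ⟨f c, by simp⟩⟩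
  rw [disjoint_filter]
  rintro c - rfl
  exact hij

/-- The number of agents without dubious chores is at least the number of agents minus the
size of the dubious allocation. -/
theorem card_le_card_filter_eq_zero_add [Fintype N] [DecidableEq M] (D : N → Multiset M)
    {k : ℕ} (hD : ∑ i, Multiset.card (D i) ≤ k) :
    Fintype.card N ≤ #{i | D i = 0} + k := by
  have h1 := card_filter_add_card_filter_not (s := (univ : Finset N)) (fun i => D i = 0)
  have h2 : #{i | ¬ D i = 0} ≤ ∑ i, Multiset.card (D i) := by
    rw [card_filter]
    refine sum_le_sum fun i _ => ?_
    split_ifs with h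
    · exact Nat.zero_le _
    · exact Multiset.card_pos.2 h
  rw [card_univ] at h1
  omega

/-- A `DEF` allocation of the reduction instance yields a solution of PARTITION. -/
theorem exists_partition_of_def {n k T : ℕ} {x : Fin n → ℕ} (hsum : ∑ i, x i = 2 * T)
    {v0 : (Fin n ⊕ Fin k) → ℤ}
    (hvmain : ∀ j : Fin n, v0 (Sum.inl j) = -(x j : ℤ))
    (hvdummy : ∀ j : Fin k, v0 (Sum.inr j) = -(T : ℤ))
    {A : Fin (2 * k + 2) → Finset (Fin n ⊕ Fin k)} (hA : IsAllocation A)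
    (hD : DEF (fun _ : Fin (2 * k + 2) => v0) A k) :
    ∃ Y : Finset (Fin n), ∑ i ∈ Y, x i = T := by
  obtain ⟨D, hcard, henvy⟩ := hD
  have hv : ∀ c, v0 c ≤ 0 := by
    rintro (j | j)
    · simp [hvmain]
    · simp [hvdummy]
  have hneg : ∀ i, val v0 (A i) ≤ 0 := fun i => sum_nonpos fun c _ => hv c
  have htot : ∑ i, val v0 (A i) = -((k + 2) * T : ℤ) := by
    rw [hA.sum_val, Fintype.sum_sum_type]
    simp only [hvmain, hvdummy, sum_neg_distrib, sum_const, card_univ, Fintype.card_fin,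
      nsmul_eq_mul]
    rw [← Nat.cast_sum, hsum]
    push_cast
    ring
  let S : Finset (Fin (2 * k + 2)) := {i | D i = 0}
  have hS : k + 2 ≤ #S := by
    have h := card_le_card_filter_eq_zero_add D hcard
    rw [Fintype.card_fin] at h
    change 2 * k + 2 ≤ #S + k at h
    omega
  have hmin : ∀ h ∈ S, ∀ i, val v0 (A h) ≤ val v0 (A i) := by
    intro h hh i
    obtain rfl | hi := eq_or_ne i h
    · exact le_rfl
    · have hDh : D h = 0 := by simpa [S] using hh
      simpa [hDh] using henvy i h hi
  choose owner howner using fun j : Fin k => hA.2 (Sum.inr j)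
  obtain ⟨h, hhS, hh⟩ : ∃ h ∈ S, h ∉ univ.image owner := by
    refine exists_mem_notMem_of_card_lt_card ?_
    have : #(univ.image owner) ≤ k := by simpa using card_image_le (s := univ) (f := owner)
    omega
  have hlower : -(T : ℤ) ≤ val v0 (A h) := by
    have h1 : ∑ i, val v0 (A i) ≤ ∑ i ∈ S, val v0 (A i) := by
      rw [← sum_add_sum_compl S]
      exact add_le_of_nonpos_right (sum_nonpos fun i _ => hneg i)
    have h2 : ∑ i ∈ S, val v0 (A i) = #S * val v0 (A h) := by
      rw [← nsmul_eq_mul]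
      exact sum_eq_card_nsmul fun i hi => le_antisymm (hmin i hi h) (hmin h hhS i)
    have h3 : ((k : ℤ) + 2) ≤ #S := by exact_mod_cast hS
    have h4 := mul_le_mul_of_nonpos_right h3 (hneg h)
    rw [h2, htot] at h1
    have h5 : ((k : ℤ) + 2) * -(T : ℤ) ≤ (k + 2) * val v0 (A h) := by linarith
    exact le_of_mul_le_mul_left h5 (by positivity)
  have hupper : val v0 (A h) ≤ -(T : ℤ) := by
    obtain rfl | hk := Nat.eq_zero_or_pos k
    · have h1 : #(univ : Finset (Fin (2 * 0 + 2))) • val v0 (A h) ≤ ∑ i, val v0 (A i) :=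
        card_nsmul_le_sum _ _ _ fun i _ => hmin h hhS i
      rw [htot] at h1
      simp at h1
      linarith
    · refine (hmin h hhS (owner ⟨0, hk⟩)).trans ?_
      rw [← hvdummy ⟨0, hk⟩]
      have h1 := single_le_sum (f := fun c => -v0 c) (fun c _ => neg_nonneg.2 (hv c))
        (howner ⟨0, hk⟩)
      rw [sum_neg_distrib] at h1
      exact neg_le_neg_iff.1 h1
  have hdummy : ∀ j, Sum.inr j ∉ A h := by
    intro j hj
    refine hh (mem_image.2 ⟨j, mem_univ j, ?_⟩)
    by_contra hne
    exact disjoint_left.1 (hA.1 _ _ hne) (howner j) hj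
  refine ⟨({j | Sum.inl j ∈ A h} : Finset (Fin n)), ?_⟩
  have hval : val v0 (A h) = -((∑ j with Sum.inl j ∈ A h, x j : ℕ) : ℤ) := by
    rw [_root_.val, ← filter_univ_mem (A h), sum_filter, Fintype.sum_sum_type]
    simp [hdummy, hvmain, ← sum_filter]
  omega

/-- A solution of PARTITION yields a `DEF` allocation of the reduction instance. -/
theorem exists_def_of_partition {n k T : ℕ} {x : Fin n → ℕ} (hsum : ∑ i, x i = 2 * T)
    {v0 : (Fin n ⊕ Fin k) → ℤ}
    (hvmain : ∀ j : Fin n, v0 (Sum.inl j) = -(x j : ℤ))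
    (hvdummy : ∀ j : Fin k, v0 (Sum.inr j) = -(T : ℤ))
    {Y : Finset (Fin n)} (hY : ∑ i ∈ Y, x i = T) :
    ∃ A : Fin (2 * k + 2) → Finset (Fin n ⊕ Fin k),
      IsAllocation A ∧ DEF (fun _ : Fin (2 * k + 2) => v0) A k := by
  let owner : Fin n ⊕ Fin k → Fin (2 * k + 2) :=
    Sum.elim (fun j => if j ∈ Y then ⟨k, by omega⟩ else ⟨k + 1, by omega⟩)
      (fun j => ⟨j, by omega⟩)
  let D : Fin (2 * k + 2) → Multiset (Fin n ⊕ Fin k) := fun i =>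
    if hi : k + 2 ≤ (i : ℕ) then {Sum.inr ⟨i - (k + 2), by omega⟩} else 0
  have hYc : ∑ i ∈ Yᶜ, x i = T := by
    have := sum_add_sum_compl Y x
    omega
  have hY' : ∑ i ∈ Y, (x i : ℤ) = T := by exact_mod_cast hY
  have hYc' : ∑ i ∈ Yᶜ, (x i : ℤ) = T := by exact_mod_cast hYc
  have hmain : ∀ i : Fin (2 * k + 2), ∑ j, (if owner (Sum.inl j) = i then v0 (Sum.inl j) else 0)
      = if (i : ℕ) = k ∨ (i : ℕ) = k + 1 then -(T : ℤ) else 0 := by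
    intro i
    by_cases h1 : (i : ℕ) = k
    · rw [if_pos (Or.inl h1), ← hY', ← sum_neg_distrib, ← sum_filter]
      refine sum_congr ?_ fun j _ => hvmain j
      ext j
      by_cases hj : j ∈ Y <;> simp [owner, hj, Fin.ext_iff, h1]
    · by_cases h2 : (i : ℕ) = k + 1
      · rw [if_pos (Or.inr h2), ← hYc', ← sum_neg_distrib, ← sum_filter]
        refine sum_congr ?_ fun j _ => hvmain j
        ext j
        by_cases hj : j ∈ Y <;> simp [owner, hj, Fin.ext_iff, h2]
      · rw [if_neg (by omega)]
        refine sum_eq_zero fun j _ => if_neg ?_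
        by_cases hj : j ∈ Y <;> simp [owner, hj, Fin.ext_iff] <;> omega
  have hdum : ∀ i : Fin (2 * k + 2), ∑ j, (if owner (Sum.inr j) = i then v0 (Sum.inr j) else 0)
      = if (i : ℕ) < k then -(T : ℤ) else 0 := by
    intro i
    split_ifs with hi
    · rw [sum_eq_single_of_mem (⟨i, hi⟩ : Fin k) (mem_univ _)]
      · simp [owner, hvdummy]
      · intro j _ hj
        refine if_neg fun h => hj ?_
        simpa [owner, Fin.ext_iff] using h
    · refine sum_eq_zero fun j _ => if_neg ?_
      simp only [owner, Sum.elim_inr, Fin.ext_iff]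
      omega
  have hval : ∀ i : Fin (2 * k + 2), val v0 (univ.filter fun c => owner c = i)
      = if (i : ℕ) < k + 2 then -(T : ℤ) else 0 := by
    intro i
    rw [_root_.val, sum_filter, Fintype.sum_sum_type, hmain, hdum]
    split_ifs <;> omega
  refine ⟨_, isAllocation_fiber owner, D, ?_, fun i h _ => ?_⟩
  · have h1 : ∀ i, Multiset.card (D i) = if k + 2 ≤ (i : ℕ) then 1 else 0 := by
      intro i
      by_cases hi : k + 2 ≤ (i : ℕ) <;> simp [D, hi]
    rw [sum_congr rfl fun i _ => h1 i,
      Fin.sum_univ_eq_sum_range (fun i => if k + 2 ≤ i then 1 else 0) (2 * k + 2),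
      show 2 * k + 2 = (k + 2) + k by omega, sum_range_add,
      sum_eq_zero fun i hi => if_neg (by simpa using hi)]
    simp
  · have h2 : (Multiset.map v0 (D h)).sum = if (h : ℕ) < k + 2 then 0 else -(T : ℤ) := by
      by_cases hh : k + 2 ≤ (h : ℕ)
      · simp [D, hh, hvdummy, not_lt.2 hh]
      · simp [D, hh, not_le.1 hh]
    simp only [hval, h2]
    split_ifs <;> omega

/-- the PARTITION reduction: the constructed identical-valuations instance
admits a DEF-k allocation iff the PARTITION instance has a solution. -/
theorem exists_def_iff_partition (n k T : ℕ)
    (x : Fin n → ℕ) (hx : ∀ i, 0 < x i)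
    (hsum : ∑ i, x i = 2 * T)
    (v0 : (Fin n ⊕ Fin k) → ℤ)
    (hvmain : ∀ j : Fin n, v0 (Sum.inl j) = -(x j : ℤ))
    (hvdummy : ∀ j : Fin k, v0 (Sum.inr j) = -(T : ℤ)) :
    (∃ A : Fin (2 * k + 2) → Finset (Fin n ⊕ Fin k),
        IsAllocation A ∧ DEF (fun _ : Fin (2 * k + 2) => v0) A k) ↔
      ∃ Y : Finset (Fin n), ∑ i ∈ Y, x i = T := by
  constructor
  · rintro ⟨A, hA, hD⟩
    exact exists_partition_of_def hsum hvmain hvdummy hA hD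
  · rintro ⟨Y, hY⟩
    exact exists_def_of_partition hsum hvmain hvdummy hY
end
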